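/- arXiv:1801.03217 — 2 statements merged into one kernel-verified Lean document; each statement's English description precedes it below -/
import Mathlib

section
/- Assume g.c.d.{k: f_k>0}=1, E[ξ]=1, Var(ξ)=2B ∈ (0,∞). Then for fixed t ∈ [0,1), a > 0, and j ≥ 1: lim_{n→∞} P(Z(⌊nt⌋, n) = j | 0 < Z(n) ≤ aBn) = ((1-t)/(1-e^{-a})) · (1/(j-1)!) ∫_0^{a/(1-t)} (tz)^{j-1} e^{-z} dz. -/
open MeasureTheory Filter Topology Asymptotics Real

/-- Probability generating function of the offspring distribution `p`. -/
noncomputable def pgf (p : ℕ → ℝ) (s : ℝ) : ℝ := ∑' k, p k * s ^ k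

/-- `n`-th functional iterate of the offspring generating function. -/
noncomputable def pgfIter (p : ℕ → ℝ) : ℕ → ℝ → ℝ
  | 0 => fun s => s
  | n + 1 => fun s => pgf p (pgfIter p n s)

/-- One minus the generating function at `1 - x`. -/
noncomputable def gwG (p : ℕ → ℝ) (x : ℝ) : ℝ := 1 - pgf p (1 - x)

/-- Second order remainder polynomials. -/
noncomputable def gwC : ℕ → ℝ → ℝ
  | 0 => fun _ => 0
  | k + 1 => fun x => (1 - x) * gwC k x + k

lemma gwC_eq (k : ℕ) (x : ℝ) : (1 - x) ^ k = 1 - k * x + x ^ 2 * gwC k x := by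
  induction k with
  | zero => simp [gwC]
  | succ k ih => rw [pow_succ, ih]; simp only [gwC]; push_cast; ring

lemma gwC_cont (k : ℕ) : Continuous (gwC k) := by
  induction k with
  | zero => exact continuous_const
  | succ k ih => simp only [gwC]; fun_prop

lemma gwC_zero (k : ℕ) : gwC k 0 = ((k : ℝ) ^ 2 - k) / 2 := by
  induction k with
  | zero => simp [gwC]
  | succ k ih => simp only [gwC, ih]; push_cast; ring

lemma gwC_nonneg (k : ℕ) {x : ℝ} (hx : x ∈ Set.Icc (0:ℝ) 1) : 0 ≤ gwC k x := by
  induction k with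
  | zero => simp [gwC]
  | succ k ih =>
    simp only [gwC]
    have : 0 ≤ 1 - x := by linarith [hx.2]
    positivity

lemma gwC_le (k : ℕ) {x : ℝ} (hx : x ∈ Set.Icc (0:ℝ) 1) : gwC k x ≤ (k : ℝ) ^ 2 := by
  induction k with
  | zero => simp [gwC]
  | succ k ih =>
    simp only [gwC]
    have h0 := gwC_nonneg k hx
    have : (1 - x) * gwC k x ≤ gwC k x := by nlinarith [hx.1]
    push_cast
    have : (0:ℝ) ≤ k := by positivity
    nlinarith

lemma gwC_ge_one (k : ℕ) (hk : 2 ≤ k) {x : ℝ} (hx : x ∈ Set.Icc (0:ℝ) 1) : 1 ≤ gwC k x := by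
  obtain ⟨m, rfl⟩ : ∃ m, k = m + 1 := ⟨k - 1, by omega⟩
  simp only [gwC]
  have h0 := gwC_nonneg m hx
  have h1 : (1:ℝ) ≤ m := by exact_mod_cast (by omega : 1 ≤ m)
  nlinarith [hx.2]

lemma gwD_nonneg (k : ℕ) {x : ℝ} (hx : x ∈ Set.Icc (0:ℝ) 1) : 0 ≤ k - x * gwC k x := by
  induction k with
  | zero => simp [gwC]
  | succ k ih =>
    have : ((k + 1 : ℕ) : ℝ) - x * gwC (k + 1) x = 1 + (1 - x) * (k - x * gwC k x) := by
      simp only [gwC]; push_cast; ring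
    rw [this]
    nlinarith [hx.2]

lemma gwD_ge_one (k : ℕ) (hk : 2 ≤ k) {x : ℝ} (hx : x ∈ Set.Icc (0:ℝ) 1) :
    1 ≤ k - x * gwC k x := by
  obtain ⟨m, rfl⟩ : ∃ m, k = m + 1 := ⟨k - 1, by omega⟩
  have : ((m + 1 : ℕ) : ℝ) - x * gwC (m + 1) x = 1 + (1 - x) * (m - x * gwC m x) := by
    simp only [gwC]; push_cast; ring
  rw [this]
  nlinarith [hx.2, gwD_nonneg m hx]

lemma gw_exists_h (p : ℕ → ℝ) (hp0 : ∀ k, 0 ≤ p k) (hp1 : ∑' k, p k = 1)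
    (hmean : ∑' k : ℕ, (k : ℝ) * p k = 1) (B : ℝ) (hB : 0 < B)
    (hsq : Summable fun k : ℕ => (k : ℝ) ^ 2 * p k)
    (hvar : (∑' k : ℕ, (k : ℝ) ^ 2 * p k) - 1 = 2 * B) :
    ∃ h : ℝ → ℝ, ContinuousOn h (Set.Icc 0 1) ∧ (∀ x ∈ Set.Icc (0:ℝ) 1, 0 < h x) ∧ h 0 = B ∧
      ∀ x ∈ Set.Icc (0:ℝ) 1, gwG p x = x / (1 + x * h x) := by
  have sp : Summable p := by
    by_contra hc
    rw [tsum_eq_zero_of_not_summable hc] at hp1; norm_num at hp1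
  have sm : Summable fun k : ℕ => (k : ℝ) * p k := by
    by_contra hc
    rw [tsum_eq_zero_of_not_summable hc] at hmean; norm_num at hmean
  obtain ⟨k0, hk2, hpk⟩ : ∃ k, 2 ≤ k ∧ 0 < p k := by
    by_contra! hc
    have : ∀ k : ℕ, (k : ℝ) ^ 2 * p k = k * p k := by
      intro k
      rcases Nat.lt_or_ge k 2 with h | h
      · interval_cases k <;> simp
      · have := le_antisymm (hc k h) (hp0 k)
        simp [this]
    rw [tsum_congr this, hmean] at hvar
    linarith
  set R : ℝ → ℝ := fun x => ∑' k, p k * gwC k x with hR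
  have sR : ∀ x ∈ Set.Icc (0:ℝ) 1, Summable fun k => p k * gwC k x := by
    intro x hx
    refine Summable.of_nonneg_of_le (fun k => mul_nonneg (hp0 k) (gwC_nonneg k hx)) (fun k => ?_) hsq
    rw [mul_comm]
    exact mul_le_mul_of_nonneg_right (gwC_le k hx) (hp0 k)
  have Rcont : ContinuousOn R (Set.Icc 0 1) := by
    refine continuousOn_tsum (fun k => (continuous_const.mul (gwC_cont k)).continuousOn) hsq ?_
    intro k x hx
    rw [Real.norm_of_nonneg (mul_nonneg (hp0 k) (gwC_nonneg k hx)), mul_comm]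
    exact mul_le_mul_of_nonneg_right (gwC_le k hx) (hp0 k)
  have Rpos : ∀ x ∈ Set.Icc (0:ℝ) 1, 0 < R x := by
    intro x hx
    refine (sR x hx).tsum_pos (fun k => mul_nonneg (hp0 k) (gwC_nonneg k hx)) k0 ?_
    have := gwC_ge_one k0 hk2 hx
    positivity
  have R0 : R 0 = B := by
    have : ∀ k : ℕ, p k * gwC k 0 = ((k : ℝ) ^ 2 * p k - k * p k) / 2 := by
      intro k; rw [gwC_zero]; ring
    simp only [hR]
    rw [tsum_congr this, tsum_div_const, hsq.tsum_sub sm, hmean]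
    linarith
  have Dpos : ∀ x ∈ Set.Icc (0:ℝ) 1, 0 < 1 - x * R x := by
    intro x hx
    have e : 1 - x * R x = ∑' k : ℕ, p k * (k - x * gwC k x) := by
      have : ∀ k : ℕ, p k * (k - x * gwC k x) = k * p k - x * (p k * gwC k x) := by
        intro k; ring
      rw [tsum_congr this, sm.tsum_sub ((sR x hx).mul_left x), hmean, tsum_mul_left]
    have s : Summable fun k : ℕ => p k * (k - x * gwC k x) := by
      have : (fun k : ℕ => p k * (k - x * gwC k x)) = fun k : ℕ => k * p k - x * (p k * gwC k x) := by
        funext k; ring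
      rw [this]
      exact sm.sub ((sR x hx).mul_left x)
    rw [e]
    refine s.tsum_pos (fun k => mul_nonneg (hp0 k) (gwD_nonneg k hx)) k0 ?_
    have := gwD_ge_one k0 hk2 hx
    positivity
  have GR : ∀ x ∈ Set.Icc (0:ℝ) 1, gwG p x = x * (1 - x * R x) := by
    intro x hx
    have : ∀ k : ℕ, p k * (1 - x) ^ k = p k - x * (k * p k) + x ^ 2 * (p k * gwC k x) := by
      intro k; rw [gwC_eq]; ring
    rw [gwG, pgf, tsum_congr this,
      (sp.sub (sm.mul_left x)).tsum_add ((sR x hx).mul_left _), sp.tsum_sub (sm.mul_left x),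
      tsum_mul_left, tsum_mul_left, hmean, hp1]
    ring
  refine ⟨fun x => R x / (1 - x * R x), ?_, ?_, ?_, ?_⟩
  · refine Rcont.div (continuousOn_const.sub (continuousOn_id.mul Rcont)) fun x hx => (Dpos x hx).ne'
  · exact fun x hx => div_pos (Rpos x hx) (Dpos x hx)
  · simp [R0]
  · intro x hx
    rw [GR x hx]
    have := (Dpos x hx).ne'
    have e : 1 + x * (R x / (1 - x * R x)) = 1 / (1 - x * R x) := by
      field_simp; ring
    rw [e, div_div_eq_mul_div, div_one]

lemma pgfIter_eq (p : ℕ → ℝ) (n : ℕ) (s : ℝ) : pgfIter p n s = 1 - (gwG p)^[n] (1 - s) := by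
  induction n with
  | zero => simp [pgfIter]
  | succ n ih =>
    rw [Function.iterate_succ_apply']
    show pgf p (pgfIter p n s) = _
    rw [ih, gwG]; ring

section iter
variable {g h : ℝ → ℝ} {B : ℝ}

lemma gw_iter (hpos : ∀ x ∈ Set.Icc (0:ℝ) 1, 0 < h x)
    (hg : ∀ x ∈ Set.Icc (0:ℝ) 1, g x = x / (1 + x * h x)) {x : ℝ} (hx : x ∈ Set.Icc (0:ℝ) 1) (m : ℕ) :
    g^[m] x ∈ Set.Icc 0 x ∧ 0 ≤ ∑ i ∈ Finset.range m, h (g^[i] x) ∧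
    g^[m] x = x / (1 + x * ∑ i ∈ Finset.range m, h (g^[i] x)) := by
  induction m with
  | zero => simpa using hx.1
  | succ m ih =>
    obtain ⟨h1, h2, h3⟩ := ih
    have hy : g^[m] x ∈ Set.Icc (0:ℝ) 1 := ⟨h1.1, h1.2.trans hx.2⟩
    have hp := hpos _ hy
    have hx0 := hx.1
    have e : g^[m+1] x = x / (1 + x * ∑ i ∈ Finset.range (m+1), h (g^[i] x)) := by
      rw [Function.iterate_succ_apply', hg _ hy, Finset.sum_range_succ]
      generalize h (g^[m] x) = H at *
      rw [h3]
      generalize ∑ i ∈ Finset.range m, h (g^[i] x) = S at *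
      have : 0 < 1 + x * S := by positivity
      have : 0 < 1 + x * (S + H) := by positivity
      have : 0 < 1 + x / (1 + x * S) * H := by positivity
      field_simp
      ring
    have s0 : 0 ≤ ∑ i ∈ Finset.range (m+1), h (g^[i] x) := by
      rw [Finset.sum_range_succ]; positivity
    refine ⟨?_, s0, e⟩
    rw [e]
    refine ⟨by positivity, div_le_self hx0 ?_⟩
    have := mul_nonneg hx0 s0
    linarith

lemma gw_sum (hc : ContinuousOn h (Set.Icc 0 1)) (hpos : ∀ x ∈ Set.Icc (0:ℝ) 1, 0 < h x) (h0 : h 0 = B)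
    (hg : ∀ x ∈ Set.Icc (0:ℝ) 1, g x = x / (1 + x * h x)) (x : ℕ → ℝ) (m : ℕ → ℕ) (τ : ℝ)
    (hx : ∀ n, x n ∈ Set.Icc (0:ℝ) 1)
    (hx0 : Tendsto x atTop (𝓝 0)) (hm : Tendsto (fun n => (m n : ℝ) / n) atTop (𝓝 τ)) :
    Tendsto (fun n => (∑ i ∈ Finset.range (m n), h (g^[i] (x n))) / n) atTop (𝓝 (B * τ)) := by
  have h1 : Tendsto (fun n => (∑ i ∈ Finset.range (m n), h (g^[i] (x n))) / n - B * ((m n : ℝ) / n))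
      atTop (𝓝 0) := by
    rw [Metric.tendsto_atTop]
    intro ε hε
    have hb : ∀ᶠ n in atTop, (m n : ℝ) / n < |τ| + 1 :=
      hm.eventually_lt_const (by linarith [le_abs_self τ])
    have hc0 : ContinuousWithinAt h (Set.Icc 0 1) 0 := hc 0 (by simp)
    rw [Metric.continuousWithinAt_iff] at hc0
    have hT : 0 < |τ| + 1 := by positivity
    obtain ⟨δ, hδ, H⟩ := hc0 (ε / (|τ| + 1)) (by positivity)
    have hxs : ∀ᶠ n in atTop, x n < δ := hx0.eventually_lt_const hδ
    obtain ⟨N, hN⟩ := eventually_atTop.1 ((hb.and hxs).and (eventually_gt_atTop 0))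
    refine ⟨N, fun n hn => ?_⟩
    obtain ⟨⟨hb, hxs⟩, hn0⟩ := hN n hn
    have hn0 : (0:ℝ) < n := by exact_mod_cast hn0
    rw [Real.dist_0_eq_abs]
    have e : (∑ i ∈ Finset.range (m n), h (g^[i] (x n))) / n - B * ((m n : ℝ) / n)
        = (∑ i ∈ Finset.range (m n), (h (g^[i] (x n)) - B)) / n := by
      rw [Finset.sum_sub_distrib]; simp; ring
    rw [e, abs_div, abs_of_pos hn0]
    have : |∑ i ∈ Finset.range (m n), (h (g^[i] (x n)) - B)| ≤ m n * (ε / (|τ| + 1)) := by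
      refine (Finset.abs_sum_le_sum_abs _ _).trans ?_
      rw [← Finset.card_range (m n), ← nsmul_eq_mul, Finset.card_range]
      conv_rhs => rw [← Finset.card_range (m n)]
      refine Finset.sum_le_card_nsmul _ _ _ fun i _ => ?_
      have hi := (gw_iter hpos hg (hx n) i).1
      have := H (x := g^[i] (x n)) ⟨hi.1, hi.2.trans (hx n).2⟩
        (by rw [Real.dist_0_eq_abs, abs_of_nonneg hi.1]; exact hi.2.trans_lt hxs)
      rw [h0, Real.dist_eq] at this
      exact this.le
    calc _ ≤ m n * (ε / (|τ| + 1)) / n := by gcongr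
      _ = (m n / n) * (ε / (|τ| + 1)) := by ring
      _ < (|τ| + 1) * (ε / (|τ| + 1)) := by gcongr
      _ = ε := by field_simp
  simpa using h1.add (hm.const_mul B)

lemma gw_lim (hB : 0 < B) (hc : ContinuousOn h (Set.Icc 0 1)) (hpos : ∀ x ∈ Set.Icc (0:ℝ) 1, 0 < h x) (h0 : h 0 = B)
    (hg : ∀ x ∈ Set.Icc (0:ℝ) 1, g x = x / (1 + x * h x)) (x : ℕ → ℝ) (m : ℕ → ℕ) (τ ξ : ℝ)
    (hx : ∀ n, x n ∈ Set.Icc (0:ℝ) 1) (hτ : 0 ≤ τ) (hξ : 0 ≤ ξ)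
    (hx0 : Tendsto (fun n : ℕ => B * n * x n) atTop (𝓝 ξ))
    (hm : Tendsto (fun n => (m n : ℝ) / n) atTop (𝓝 τ)) :
    Tendsto (fun n : ℕ => B * n * g^[m n] (x n)) atTop (𝓝 (ξ / (1 + τ * ξ))) := by
  have hxz : Tendsto x atTop (𝓝 0) := by
    have h1 : Tendsto (fun n : ℕ => (B * n)⁻¹) atTop (𝓝 0) :=
      (tendsto_natCast_atTop_atTop.const_mul_atTop hB).inv_tendsto_atTop
    have := h1.mul hx0
    rw [zero_mul] at this
    refine this.congr' ?_
    filter_upwards [eventually_gt_atTop 0] with n hn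
    have hn : (0:ℝ) < n := by exact_mod_cast hn
    field_simp
  have hS := gw_sum hc hpos h0 hg x m τ hx hxz hm
  have hS' := (hS.div_const B).mul hx0
  have := hx0.div (hS'.const_add 1) (by
    rw [mul_div_cancel_left₀ _ hB.ne']
    positivity)
  rw [mul_div_cancel_left₀ _ hB.ne'] at this
  refine this.congr' ?_
  filter_upwards [eventually_gt_atTop 0] with n hn
  have hn : (0:ℝ) < n := by exact_mod_cast hn
  rw [Pi.div_apply, (gw_iter hpos hg (hx n) (m n)).2.2]
  generalize ∑ i ∈ Finset.range (m n), h (g^[i] (x n)) = S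
  rw [← mul_div_assoc]
  congr 2
  field_simp

lemma gw_Q (hB : 0 < B) (hc : ContinuousOn h (Set.Icc 0 1)) (hpos : ∀ x ∈ Set.Icc (0:ℝ) 1, 0 < h x) (h0 : h 0 = B)
    (hg : ∀ x ∈ Set.Icc (0:ℝ) 1, g x = x / (1 + x * h x)) :
    Tendsto (fun n : ℕ => B * n * g^[n] 1) atTop (𝓝 1) := by
  obtain ⟨z, hz, hmin⟩ := isCompact_Icc.exists_isMinOn (Set.nonempty_Icc.2 zero_le_one) hc
  have hcz := hpos z hz
  have h1 : (1:ℝ) ∈ Set.Icc (0:ℝ) 1 := by simp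
  have hit := fun m => gw_iter hpos hg h1 m
  have hb : ∀ n : ℕ, g^[n] 1 ≤ 1 / (1 + n * h z) := by
    intro n
    rw [(hit n).2.2]
    have : n * h z ≤ ∑ i ∈ Finset.range n, h (g^[i] 1) := by
      rw [← nsmul_eq_mul]
      conv_lhs => rw [← Finset.card_range n]
      exact Finset.card_nsmul_le_sum _ _ _ fun i _ => hmin ⟨(hit i).1.1, (hit i).1.2⟩
    rw [one_mul]
    have : 0 < 1 + n * h z := by positivity
    gcongr
  have hz0 : Tendsto (fun n => g^[n] (1:ℝ)) atTop (𝓝 0) := by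
    refine squeeze_zero (fun n => (hit n).1.1) hb ?_
    simp only [one_div]
    exact (tendsto_atTop_add_const_left _ _
      (tendsto_natCast_atTop_atTop.atTop_mul_const hcz)).inv_tendsto_atTop
  have hh : Tendsto (fun n => h (g^[n] (1:ℝ))) atTop (𝓝 B) := by
    rw [← h0]
    refine (hc 0 (by simp)).tendsto.comp (tendsto_nhdsWithin_iff.2 ⟨hz0, ?_⟩)
    exact Eventually.of_forall fun n => (hit n).1
  have hS := hh.cesaro
  have hi : Tendsto (fun n : ℕ => (n:ℝ)⁻¹) atTop (𝓝 0) := tendsto_inv_atTop_nhds_zero_nat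
  have := (tendsto_const_nhds (x := B)).div (hi.add hS) (by simpa using hB.ne')
  rw [zero_add, div_self hB.ne'] at this
  refine this.congr' ?_
  filter_upwards [eventually_gt_atTop 0] with n hn
  have hn : (0:ℝ) < n := by exact_mod_cast hn
  have hs := (hit n).2.1
  rw [Pi.div_apply, (hit n).2.2]
  generalize ∑ i ∈ Finset.range n, h (g^[i] 1) = S at *
  have : 0 < 1 + S := by positivity
  field_simp

end iter
section moments
variable {Ω : Type*} [MeasurableSpace Ω] (μ : Measure Ω) [IsProbabilityMeasure μ]

lemma gw_int (W Z : Ω → ℕ) (hW : Measurable W) (hZ : Measurable Z) {s u : ℝ}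
    (hs : s ∈ Set.Icc (0:ℝ) 1) (hu : u ∈ Set.Icc (0:ℝ) 1) :
    Integrable (fun ω => s ^ W ω * u ^ Z ω) μ := by
  refine Integrable.of_bound (C := 1) ?_ (Eventually.of_forall fun ω => ?_)
  · have h1 : Measurable fun ω => s ^ W ω := (measurable_from_nat (f := fun k => s ^ k)).comp hW
    have h2 : Measurable fun ω => u ^ Z ω := (measurable_from_nat (f := fun k => u ^ k)).comp hZ
    exact (h1.mul h2).aestronglyMeasurable
  · have a1 := pow_nonneg hs.1 (W ω)
    have a2 := pow_nonneg hu.1 (Z ω)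
    rw [Real.norm_of_nonneg (by positivity)]
    exact mul_le_one₀ (pow_le_one₀ hs.1 hs.2) a2 (pow_le_one₀ hu.1 hu.2)

lemma gw_setInt (W Z : Ω → ℕ) (hW : Measurable W) (hZ : Measurable Z) {s u : ℝ}
    (hs : s ∈ Set.Icc (0:ℝ) 1) (hu : u ∈ Set.Icc (0:ℝ) 1) :
    ∫ ω in {ω | 0 < Z ω}, s ^ W ω * u ^ Z ω ∂μ =
      ∫ ω, s ^ W ω * u ^ Z ω ∂μ - ∫ ω, s ^ W ω * 0 ^ Z ω ∂μ := by
  have hm : MeasurableSet {ω | 0 < Z ω} := measurableSet_lt measurable_const hZ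
  rw [← integral_indicator hm, ← integral_sub (gw_int μ W Z hW hZ hs hu)
    (gw_int μ W Z hW hZ hs (by simp))]
  congr 1
  funext ω
  by_cases h : 0 < Z ω
  · rw [Set.indicator_of_mem (by exact h), zero_pow h.ne']; ring
  · rw [Set.indicator_of_notMem (by exact h)]
    have : Z ω = 0 := by omega
    rw [this]; ring

lemma gw_exp_lim {B : ℝ} (hB : 0 < B) (l : ℝ) :
    Tendsto (fun n : ℕ => B * n * (1 - Real.exp (-(l / (B * n))))) atTop (𝓝 l) := by
  have h1 : Tendsto (fun n : ℕ => l / (B * (n:ℝ))) atTop (𝓝 0) :=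
    (tendsto_natCast_atTop_atTop.const_mul_atTop hB).const_div_atTop l
  by_cases hl : l = 0
  · simp [hl]
  have hd : HasDerivAt (fun x : ℝ => 1 - Real.exp (-x)) 1 0 := by
    have := ((hasDerivAt_neg (0:ℝ)).exp).const_sub 1
    simpa using this
  have h2 := hd.tendsto_slope_zero
  have h3 : Tendsto (fun n : ℕ => l / (B * (n:ℝ))) atTop (𝓝[≠] 0) := by
    refine tendsto_nhdsWithin_iff.2 ⟨h1, ?_⟩
    filter_upwards [eventually_gt_atTop 0] with n hn
    have hn : (0:ℝ) < n := by exact_mod_cast hn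
    simp only [Set.mem_compl_iff, Set.mem_singleton_iff]
    positivity
  have h4 := (h2.comp h3).const_mul l
  rw [mul_one] at h4
  refine h4.congr' ?_
  filter_upwards [eventually_gt_atTop 0] with n hn
  have hn : (0:ℝ) < n := by exact_mod_cast hn
  simp only [Function.comp, zero_add, neg_zero, Real.exp_zero, sub_self, sub_zero, smul_eq_mul]
  field_simp

lemma gw_u_mem {B : ℝ} (hB : 0 < B) (l : ℕ) (n : ℕ) :
    Real.exp (-((l:ℝ) / (B * n))) ∈ Set.Icc (0:ℝ) 1 := by
  refine ⟨(Real.exp_pos _).le, Real.exp_le_one_iff.2 ?_⟩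
  have : 0 ≤ (l:ℝ) / (B * n) := by positivity
  linarith

lemma gw_u_mem' {B : ℝ} (hB : 0 < B) (l : ℕ) (n : ℕ) :
    1 - Real.exp (-((l:ℝ) / (B * n))) ∈ Set.Icc (0:ℝ) 1 := by
  have := gw_u_mem hB l n
  exact ⟨by linarith [this.2], by linarith [this.1]⟩

lemma gw_moment_den (p : ℕ → ℝ) (hp0 : ∀ k, 0 ≤ p k) (hp1 : ∑' k, p k = 1)
    (hmean : ∑' k : ℕ, (k : ℝ) * p k = 1) (B : ℝ) (hB : 0 < B)
    (hsq : Summable fun k : ℕ => (k : ℝ) ^ 2 * p k)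
    (hvar : (∑' k : ℕ, (k : ℝ) ^ 2 * p k) - 1 = 2 * B)
    (Z : ℕ → Ω → ℕ) (hZm : ∀ n, Measurable (Z n))
    (hZ : ∀ n, ∀ s ∈ Set.Icc (0 : ℝ) 1, ∫ ω, s ^ Z n ω ∂μ = pgfIter p n s)
    (s : ℝ) (hs : s ∈ Set.Icc (0:ℝ) 1) (l : ℕ) :
    Tendsto (fun n : ℕ => B * n * ∫ ω in {ω | 0 < Z n ω},
      s ^ (1:ℕ) * Real.exp (-((l:ℝ) / (B * n))) ^ Z n ω ∂μ) atTop
      (𝓝 ((1 - 0) * (s * (1 / (1 + l * (1 - 0)))) / (1 - 0 * (s * (1 / (1 + l * (1 - 0))))))) := by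
  obtain ⟨h, hc, hpos, h0, hg⟩ := gw_exists_h p hp0 hp1 hmean B hB hsq hvar
  have hQ := gw_Q hB hc hpos h0 hg
  have hm : Tendsto (fun n : ℕ => (n:ℝ) / n) atTop (𝓝 1) := by
    refine (tendsto_const_nhds (x := (1:ℝ))).congr' ?_
    filter_upwards [eventually_gt_atTop 0] with n hn
    have hn : (0:ℝ) < n := by exact_mod_cast hn
    field_simp
  have hy := gw_lim hB hc hpos h0 hg _ (fun n => n) 1 l (gw_u_mem' hB l) zero_le_one
    (Nat.cast_nonneg l) (gw_exp_lim hB l) hm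
  have := (hQ.sub hy).const_mul s
  have e : s * (1 - (l:ℝ) / (1 + 1 * l)) =
      ((1 - 0) * (s * (1 / (1 + l * (1 - 0)))) / (1 - 0 * (s * (1 / (1 + l * (1 - 0)))))) := by
    have : (0:ℝ) < 1 + l := by positivity
    rw [one_mul, sub_zero, zero_mul, sub_zero, mul_one]
    field_simp
    ring
  rw [e] at this
  refine this.congr fun n => ?_
  rw [gw_setInt μ (fun _ => 1) (Z n) measurable_const (hZm n) hs (gw_u_mem hB l n),
    integral_const_mul, integral_const_mul, hZ n _ (gw_u_mem hB l n), hZ n 0 (by simp),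
    pgfIter_eq, pgfIter_eq]
  simp only [sub_zero]
  ring

lemma gw_moment_num (p : ℕ → ℝ) (hp0 : ∀ k, 0 ≤ p k) (hp1 : ∑' k, p k = 1)
    (hmean : ∑' k : ℕ, (k : ℝ) * p k = 1) (B : ℝ) (hB : 0 < B)
    (hsq : Summable fun k : ℕ => (k : ℝ) ^ 2 * p k)
    (hvar : (∑' k : ℕ, (k : ℝ) ^ 2 * p k) - 1 = 2 * B)
    (Z : ℕ → Ω → ℕ) (hZm : ∀ n, Measurable (Z n))
    (Zred : ℕ → ℕ → Ω → ℕ) (hZredm : ∀ m n, Measurable (Zred m n))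
    (hjoint : ∀ m n, m ≤ n → ∀ s ∈ Set.Icc (0 : ℝ) 1, ∀ u ∈ Set.Icc (0 : ℝ) 1,
      ∫ ω, s ^ Zred m n ω * u ^ Z n ω ∂μ =
        pgfIter p m (pgfIter p (n - m) 0 +
          s * (pgfIter p (n - m) u - pgfIter p (n - m) 0)))
    (t : ℝ) (ht0 : 0 ≤ t) (ht1 : t < 1)
    (s : ℝ) (hs : s ∈ Set.Icc (0:ℝ) 1) (l : ℕ) :
    Tendsto (fun n : ℕ => B * n * ∫ ω in {ω | 0 < Z n ω},
      s ^ (Zred ⌊t * (n : ℝ)⌋₊ n ω) * Real.exp (-((l:ℝ) / (B * n))) ^ Z n ω ∂μ) atTop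
      (𝓝 ((1 - t) * (s * (1 / (1 + l * (1 - t)))) / (1 - t * (s * (1 / (1 + l * (1 - t))))))) := by
  obtain ⟨h, hc, hpos, h0, hg⟩ := gw_exists_h p hp0 hp1 hmean B hB hsq hvar
  have ht : 0 < 1 - t := by linarith
  have hQ := gw_Q hB hc hpos h0 hg
  have hmn : ∀ n : ℕ, ⌊t * (n:ℝ)⌋₊ ≤ n := fun n => by
    refine Nat.floor_le_of_le ?_
    have : (0:ℝ) ≤ n := by positivity
    nlinarith
  have hm : Tendsto (fun n : ℕ => (⌊t * (n:ℝ)⌋₊:ℝ) / n) atTop (𝓝 t) :=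
    (tendsto_nat_floor_mul_div_atTop ht0).comp tendsto_natCast_atTop_atTop
  have hr : Tendsto (fun n : ℕ => ((n - ⌊t * (n:ℝ)⌋₊ : ℕ):ℝ) / n) atTop (𝓝 (1 - t)) := by
    refine (hm.const_sub 1).congr' ?_
    filter_upwards [eventually_gt_atTop 0] with n hn
    have hn : (0:ℝ) < n := by exact_mod_cast hn
    rw [Nat.cast_sub (hmn n)]
    field_simp
  have hrtop : Tendsto (fun n : ℕ => n - ⌊t * (n:ℝ)⌋₊) atTop atTop := by
    rw [← tendsto_natCast_atTop_iff (R := ℝ)]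
    refine (hr.pos_mul_atTop ht tendsto_natCast_atTop_atTop).congr' ?_
    filter_upwards [eventually_gt_atTop 0] with n hn
    have hn : (0:ℝ) < n := by exact_mod_cast hn
    field_simp
  have hy := gw_lim hB hc hpos h0 hg _ (fun n : ℕ => n - ⌊t * (n:ℝ)⌋₊) (1 - t) l (gw_u_mem' hB l) ht.le
    (Nat.cast_nonneg l) (gw_exp_lim hB l) hr
  have hq : Tendsto (fun n : ℕ => B * n * (gwG p)^[n - ⌊t * (n:ℝ)⌋₊] 1) atTop (𝓝 (1 / (1 - t))) := by
    refine ((hQ.comp hrtop).div hr ht.ne').congr' ?_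
    filter_upwards [eventually_gt_atTop 0, hrtop.eventually_gt_atTop 0] with n hn hn'
    have hn : (0:ℝ) < n := by exact_mod_cast hn
    have hn' : (0:ℝ) < ((n - ⌊t * (n:ℝ)⌋₊ : ℕ):ℝ) := by exact_mod_cast hn'
    simp only [Function.comp, Pi.div_apply]
    field_simp
  have q01 : ∀ n : ℕ, (gwG p)^[n - ⌊t * (n:ℝ)⌋₊] 1 ∈ Set.Icc (0:ℝ) 1 := fun n =>
    (gw_iter hpos hg (x := 1) (by simp) _).1
  have y01 : ∀ n : ℕ, (gwG p)^[n - ⌊t * (n:ℝ)⌋₊] (1 - Real.exp (-((l:ℝ) / (B * n)))) ∈ Set.Icc (0:ℝ) 1 :=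
    fun n => by
      have := (gw_iter hpos hg (gw_u_mem' hB l n) (n - ⌊t * (n:ℝ)⌋₊)).1
      exact ⟨this.1, this.2.trans (gw_u_mem' hB l n).2⟩
  have hden : 0 < 1 + (1 - t) * l := by positivity
  have a1 := gw_lim hB hc hpos h0 hg _ (fun n : ℕ => ⌊t * (n:ℝ)⌋₊) t (1 / (1 - t)) q01 ht0
    (by positivity) hq hm
  have x01 : ∀ n : ℕ, (1 - s) * (gwG p)^[n - ⌊t * (n:ℝ)⌋₊] 1 +
      s * (gwG p)^[n - ⌊t * (n:ℝ)⌋₊] (1 - Real.exp (-((l:ℝ) / (B * n)))) ∈ Set.Icc (0:ℝ) 1 := fun n =>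
    convex_Icc (0:ℝ) 1 (q01 n) (y01 n) (by linarith [hs.2]) hs.1 (by ring)
  have hx : Tendsto (fun n : ℕ => B * n * ((1 - s) * (gwG p)^[n - ⌊t * (n:ℝ)⌋₊] 1 +
      s * (gwG p)^[n - ⌊t * (n:ℝ)⌋₊] (1 - Real.exp (-((l:ℝ) / (B * n)))))) atTop
      (𝓝 ((1 - s) * (1 / (1 - t)) + s * (l / (1 + (1 - t) * l)))) := by
    refine ((hq.const_mul (1 - s)).add (hy.const_mul s)).congr fun n => ?_
    ring
  have hs1 : 0 ≤ 1 - s := by linarith [hs.2]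
  have hs0 := hs.1
  have a2 := gw_lim hB hc hpos h0 hg _ (fun n : ℕ => ⌊t * (n:ℝ)⌋₊) t _ x01 ht0
    (by positivity) hx hm
  have := a1.sub a2
  have e : 1 / (1 - t) / (1 + t * (1 / (1 - t))) - ((1 - s) * (1 / (1 - t)) + s * (l / (1 + (1 - t) * l))) /
        (1 + t * ((1 - s) * (1 / (1 - t)) + s * (l / (1 + (1 - t) * l)))) =
      ((1 - t) * (s * (1 / (1 + l * (1 - t)))) / (1 - t * (s * (1 / (1 + l * (1 - t)))))) := by
    have hd2 : 0 < 1 + l * (1 - t) := by positivity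
    set φ := 1 / (1 + l * (1 - t)) with hφ
    have hφ1 : φ ≤ 1 := by
      rw [hφ, div_le_one hd2]
      have : 0 ≤ l * (1 - t) := by positivity
      linarith
    have hφ0 : 0 ≤ φ := by positivity
    have hsφ : s * φ ≤ 1 := mul_le_one₀ hs.2 hφ0 hφ1
    have hsφ0 : 0 ≤ s * φ := by positivity
    have e1 : (1 - s) * (1 / (1 - t)) + s * (l / (1 + (1 - t) * l)) = (1 - s * φ) / (1 - t) := by
      rw [hφ]; field_simp; ring
    rw [e1]
    have d3 : 0 < 1 - t * (s * φ) := by nlinarith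
    have e2 : 1 + t * (1 / (1 - t)) = 1 / (1 - t) := by field_simp; ring
    have e3 : 1 + t * ((1 - s * φ) / (1 - t)) = (1 - t * (s * φ)) / (1 - t) := by field_simp; ring
    rw [e2, e3, div_div_div_cancel_right₀ ht.ne', div_self (by positivity),
      div_div_div_cancel_right₀ ht.ne', eq_div_iff d3.ne', sub_mul, div_mul_cancel₀ _ d3.ne']
    ring
  rw [e] at this
  refine this.congr fun n => ?_
  rw [gw_setInt μ _ (Z n) (hZredm _ n) (hZm n) hs (gw_u_mem hB l n),
    hjoint _ n (hmn n) s hs _ (gw_u_mem hB l n), hjoint _ n (hmn n) s hs 0 (by simp)]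
  simp only [pgfIter_eq, sub_zero, sub_self, mul_zero, add_zero]
  have e4 : ∀ q y : ℝ, 1 - (1 - q + s * (1 - y - (1 - q))) = (1 - s) * q + s * y := by
    intro q y; ring
  rw [e4, sub_sub_cancel]
  ring

end moments
section weak
open unitInterval

lemma gw_sw (ν : ℕ → FiniteMeasure (I × I)) (ν0 : FiniteMeasure (I × I))
    (H : ∀ k l : ℕ, Tendsto (fun n => ∫ q, (q.1:ℝ) ^ k * (q.2:ℝ) ^ l ∂(ν n : Measure (I × I))) atTop
      (𝓝 (∫ q, (q.1:ℝ) ^ k * (q.2:ℝ) ^ l ∂(ν0 : Measure (I × I))))) :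
    Tendsto ν atTop (𝓝 ν0) := by
  have hint : ∀ (m : FiniteMeasure (I × I)) (F : C(I × I, ℝ)), Integrable F (m : Measure (I × I)) :=
    fun m F => (BoundedContinuousFunction.mkOfCompact F).integrable _
  let X : C(I × I, ℝ) := ⟨fun q => (q.1:ℝ), by fun_prop⟩
  let Y : C(I × I, ℝ) := ⟨fun q => (q.2:ℝ), by fun_prop⟩
  let A : Subalgebra ℝ C(I × I, ℝ) := Algebra.adjoin ℝ {X, Y}
  have hA : A.SeparatesPoints := by
    rintro ⟨x1, x2⟩ ⟨y1, y2⟩ hne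
    by_cases h : x1 = y1
    · have h2 : x2 ≠ y2 := fun h2 => hne (by rw [h, h2])
      exact ⟨_, ⟨Y, Algebra.subset_adjoin (by simp), rfl⟩, fun h' => h2 (Subtype.ext h')⟩
    · exact ⟨_, ⟨X, Algebra.subset_adjoin (by simp), rfl⟩, fun h' => h (Subtype.ext h')⟩
  have hconvA : ∀ F ∈ A, Tendsto (fun n => ∫ q, F q ∂(ν n : Measure (I × I))) atTop
      (𝓝 (∫ q, F q ∂(ν0 : Measure (I × I)))) := by
    intro F hF
    have hF' : F ∈ Submodule.span ℝ ((Submonoid.closure {X, Y} : Submonoid C(I × I, ℝ)) : Set C(I × I, ℝ)) := by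
      rw [← Algebra.adjoin_eq_span]; exact hF
    induction hF' using Submodule.span_induction with
    | mem F h =>
      obtain ⟨k, l, rfl⟩ := (Submonoid.mem_closure_pair _ _ _).1 h
      exact H k l
    | zero => simp
    | add F G _ _ h1 h2 =>
      rename_i hF1 hG1
      have h1' := h1 (by rw [← Algebra.adjoin_eq_span] at hF1; exact hF1)
      have h2' := h2 (by rw [← Algebra.adjoin_eq_span] at hG1; exact hG1)
      have e : ∀ m : FiniteMeasure (I × I), ∫ q, (F + G) q ∂(m : Measure (I × I)) =
          ∫ q, F q ∂(m : Measure (I × I)) + ∫ q, G q ∂(m : Measure (I × I)) := fun m => by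
        simp only [ContinuousMap.add_apply]
        exact integral_add (hint m F) (hint m G)
      simp only [e]
      exact h1'.add h2'
    | smul c F _ h1 =>
      rename_i hF1
      have h1' := h1 (by rw [← Algebra.adjoin_eq_span] at hF1; exact hF1)
      simp only [ContinuousMap.smul_apply, smul_eq_mul, integral_const_mul]
      exact h1'.const_mul c
  rw [FiniteMeasure.tendsto_iff_forall_integral_tendsto]
  intro f
  have hmass : Tendsto (fun n => (ν n : Measure (I × I)).real Set.univ) atTop
      (𝓝 ((ν0 : Measure (I × I)).real Set.univ)) := by
    simpa using H 0 0
  set M := (ν0 : Measure (I × I)).real Set.univ with hM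
  have hM0 : 0 ≤ M := measureReal_nonneg
  rw [Metric.tendsto_atTop]
  intro ε hε
  obtain ⟨⟨G, hG⟩, hGF⟩ := ContinuousMap.exists_mem_subalgebra_near_continuousMap_of_separatesPoints A hA
    f.toContinuousMap (ε / (4 * (M + 1))) (by positivity)
  set δ := ε / (4 * (M + 1)) with hδ
  have hδ0 : 0 < δ := by positivity
  have hdiff : ∀ m : FiniteMeasure (I × I), |∫ q, f q ∂(m : Measure (I × I)) - ∫ q, G q ∂(m : Measure (I × I))| ≤
      δ * (m : Measure (I × I)).real Set.univ := by
    intro m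
    rw [← integral_sub (f.integrable _) (hint m G), ← Real.norm_eq_abs]
    refine norm_integral_le_of_norm_le_const (Eventually.of_forall fun q => ?_)
    have h1 := (G - f.toContinuousMap).norm_coe_le_norm q
    have h2 : ‖G - f.toContinuousMap‖ ≤ δ := hGF.le
    rw [norm_sub_rev]
    exact h1.trans h2
  have e1 := (Metric.tendsto_atTop.1 (hconvA G hG)) (ε / 4) (by positivity)
  have e2 := hmass.eventually_lt_const (show M < M + 1 by linarith)
  obtain ⟨N1, hN1⟩ := e1
  obtain ⟨N2, hN2⟩ := eventually_atTop.1 e2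
  refine ⟨max N1 N2, fun n hn => ?_⟩
  have a1 := hN1 n ((le_max_left _ _).trans hn)
  have a2 := hN2 n ((le_max_right _ _).trans hn)
  rw [Real.dist_eq] at a1 ⊢
  have b1 := hdiff (ν n)
  have b2 := hdiff ν0
  have c1 : δ * (ν n : Measure (I × I)).real Set.univ ≤ ε / 4 := by
    calc _ ≤ δ * (M + 1) := by gcongr
      _ = ε / 4 := by rw [hδ]; field_simp
  have c2 : δ * (ν0 : Measure (I × I)).real Set.univ ≤ ε / 4 := by
    calc _ ≤ δ * (M + 1) := by gcongr; linarith
      _ = ε / 4 := by rw [hδ]; field_simp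
  have b1' := abs_le.1 (b1.trans c1)
  have b2' := abs_le.1 (b2.trans c2)
  have a1' := abs_lt.1 a1
  rw [abs_lt]
  constructor <;> linarith [b1'.1, b1'.2, b2'.1, b2'.2, a1'.1, a1'.2]

lemma gw_portmanteau (ν : ℕ → FiniteMeasure (I × I)) (ν0 : FiniteMeasure (I × I))
    (h : Tendsto ν atTop (𝓝 ν0)) (hne : ν0 ≠ 0) (E : Set (I × I))
    (hE : (ν0 : Measure (I × I)) (frontier E) = 0) :
    Tendsto (fun n => (ν n : Measure (I × I)).real E) atTop (𝓝 ((ν0 : Measure (I × I)).real E)) := by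
  have hn := FiniteMeasure.tendsto_normalize_of_tendsto h hne
  have h0 : ν0.normalize (frontier E) = 0 := by
    rw [FiniteMeasure.normalize_eq_of_nonzero _ hne]
    have : ν0 (frontier E) = 0 := by
      rw [FiniteMeasure.null_iff_toMeasure_null]; exact hE
    rw [this, mul_zero]
  have h1 := ProbabilityMeasure.tendsto_measure_of_null_frontier_of_tendsto hn h0
  have h2 := h.mass.mul h1
  have e : ∀ m : FiniteMeasure (I × I), m.mass * m.normalize E = m E := fun m =>
    (FiniteMeasure.self_eq_mass_mul_normalize m E).symm
  simp only [e] at h2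
  exact (NNReal.tendsto_coe.2 h2)
end weak
section core
open unitInterval

/-- The compactification map. -/
noncomputable def gwT (k : ℕ) (z : ℝ) : I × I :=
  (⟨(1 / 2 : ℝ) ^ k, by positivity, pow_le_one₀ (by norm_num) (by norm_num)⟩,
    Set.projIcc 0 1 zero_le_one (Real.exp (-z)))

lemma gwT_fst (k : ℕ) (z : ℝ) : ((gwT k z).1 : ℝ) = (1 / 2) ^ k := rfl

lemma gwT_snd (k : ℕ) {z : ℝ} (hz : 0 ≤ z) : ((gwT k z).2 : ℝ) = Real.exp (-z) := by
  have : Real.exp (-z) ∈ Set.Icc (0:ℝ) 1 := ⟨(Real.exp_pos _).le, Real.exp_le_one_iff.2 (by linarith)⟩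
  simp only [gwT]
  rw [Set.projIcc_of_mem _ this]

lemma gwT_snd' (k : ℕ) (z : ℝ) : ((gwT k z).2 : ℝ) = max 0 (min 1 (Real.exp (-z))) := rfl

lemma gwT_snd_le (k : ℕ) {z a : ℝ} (ha : 0 < a) : Real.exp (-a) ≤ ((gwT k z).2 : ℝ) ↔ z ≤ a := by
  rw [gwT_snd', le_max_iff, le_min_iff, Real.exp_le_exp]
  have h1 : ¬ (Real.exp (-a) ≤ 0) := not_le.2 (Real.exp_pos _)
  have h2 : Real.exp (-a) ≤ 1 := Real.exp_le_one_iff.2 (by linarith)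
  simp only [h1, h2, true_and, false_or]
  exact neg_le_neg_iff

lemma gwT_snd_eq (k : ℕ) {z a : ℝ} (ha : 0 < a) (h : ((gwT k z).2 : ℝ) = Real.exp (-a)) : z = a := by
  have h1 : z ≤ a := (gwT_snd_le k ha).1 h.symm.le
  by_contra hne
  have h2 : z < a := lt_of_le_of_ne h1 hne
  rcases le_or_gt 0 z with hz | hz
  · rw [gwT_snd k hz, Real.exp_eq_exp] at h
    linarith
  · have := (gwT_snd_le (a := a / 2) k (z := z) (by linarith)).2 (by linarith)
    rw [h, Real.exp_le_exp] at this
    linarith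

lemma gwT_meas : Measurable (Function.uncurry gwT) := by
  refine measurable_from_prod_countable_right fun k => ?_
  have : Continuous (gwT k) := by
    unfold gwT
    exact continuous_const.prodMk (continuous_projIcc.comp (by fun_prop))
  exact this.measurable

lemma gw_half {i j : ℕ} (h : i ≠ j) : (1 / 2 : ℝ) ^ j / 4 < |(1 / 2 : ℝ) ^ i - (1 / 2) ^ j| := by
  have hj : (0:ℝ) < (1 / 2) ^ j := by positivity
  rcases lt_or_gt_of_ne h with h | h
  · have : (1 / 2 : ℝ) ^ j ≤ (1 / 2) ^ (i + 1) :=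
      pow_le_pow_of_le_one (by norm_num) (by norm_num) h
    rw [pow_succ] at this
    refine lt_of_lt_of_le ?_ (le_abs_self _)
    linarith
  · have : (1 / 2 : ℝ) ^ i ≤ (1 / 2) ^ (j + 1) :=
      pow_le_pow_of_le_one (by norm_num) (by norm_num) h
    rw [pow_succ] at this
    refine lt_of_lt_of_le ?_ (neg_le_abs _)
    linarith

/-- The test set. -/
def gwE (j : ℕ) (a : ℝ) : Set (I × I) :=
  {q | |(q.1 : ℝ) - (1 / 2) ^ j| ≤ (1 / 2) ^ j / 4} ∩ {q | Real.exp (-a) ≤ (q.2 : ℝ)}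

lemma gwE_meas (j : ℕ) (a : ℝ) : MeasurableSet (gwE j a) :=
  ((isClosed_le (by fun_prop) (by fun_prop)).inter (isClosed_le (by fun_prop) (by fun_prop))).measurableSet

lemma gwE_mem (j : ℕ) {a : ℝ} (ha : 0 < a) (k : ℕ) (z : ℝ) : gwT k z ∈ gwE j a ↔ k = j ∧ z ≤ a := by
  simp only [gwE, Set.mem_inter_iff, Set.mem_ofPred_eq, gwT_snd_le k ha, gwT_fst]
  refine and_congr_left fun _ => ⟨fun h => ?_, fun h => ?_⟩
  · by_contra hne
    exact absurd (gw_half hne) (not_lt.2 h)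
  · subst h
    rw [sub_self, abs_zero]
    positivity

lemma gwE_frontier (j : ℕ) {a : ℝ} (ha : 0 < a) (k : ℕ) (z : ℝ) (h : gwT k z ∈ frontier (gwE j a)) :
    z = a := by
  have h1 := frontier_inter_subset _ _ h
  rcases h1 with h1 | h1
  · have := frontier_le_subset_eq (by fun_prop) (by fun_prop) h1.1
    simp only [Set.mem_ofPred_eq, gwT_fst] at this
    exfalso
    by_cases hk : k = j
    · subst hk
      have hj : (0:ℝ) < (1 / 2) ^ k := by positivity
      rw [sub_self, abs_zero] at this
      linarith
    · exact absurd this (gw_half hk).ne'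
  · have := frontier_le_subset_eq (by fun_prop) (by fun_prop) h1.2
    exact gwT_snd_eq k ha this.symm

/-- Limit density. -/
noncomputable def gwd (t : ℝ) (i : ℕ) (z : ℝ) : ℝ :=
  (1 - t) * (1 / (Nat.factorial i : ℝ)) * ((t * z) ^ i * Real.exp (-z))

lemma gw_gamma (i : ℕ) {r : ℝ} (hr : 0 < r) :
    IntegrableOn (fun z : ℝ => z ^ i * Real.exp (-(r * z))) (Set.Ioi 0) ∧
    ∫ z in Set.Ioi (0:ℝ), z ^ i * Real.exp (-(r * z)) = (Nat.factorial i : ℝ) * (1 / r) ^ (i + 1) := by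
  have h := Real.integral_rpow_mul_exp_neg_mul_Ioi (a := (i:ℝ) + 1) (by positivity) hr
  simp only [add_sub_cancel_right, Real.rpow_natCast, Real.Gamma_nat_eq_factorial] at h
  have e : (1 / r) ^ ((i:ℝ) + 1) = (1 / r) ^ (i + 1) := by
    rw [← Real.rpow_natCast]; push_cast; rfl
  rw [e, mul_comm] at h
  refine ⟨?_, h⟩
  by_contra hc
  rw [integral_undef hc] at h
  have : 0 < (Nat.factorial i : ℝ) * (1 / r) ^ (i + 1) := by positivity
  linarith

lemma gwd_nonneg {t : ℝ} (ht0 : 0 ≤ t) (ht1 : t < 1) (i : ℕ) {z : ℝ} (hz : 0 ≤ z) : 0 ≤ gwd t i z := by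
  have : 0 < 1 - t := by linarith
  unfold gwd; positivity

lemma gwd_cont (t : ℝ) (i : ℕ) : Continuous (gwd t i) := by unfold gwd; fun_prop

/-- Pieces of the limit measure. -/
noncomputable def gwrho (t : ℝ) (i : ℕ) : Measure ℝ :=
  (volume.restrict (Set.Ioi (0:ℝ))).withDensity fun z => ENNReal.ofReal (gwd t i z)

/-- The limit measure. -/
noncomputable def gwnu (t : ℝ) : Measure (I × I) :=
  Measure.sum fun i => (gwrho t i).map fun z => gwT (i + 1) ((1 - t) * z)

lemma gwTi_meas (t : ℝ) (i : ℕ) : Measurable fun z => gwT (i + 1) ((1 - t) * z) :=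
  gwT_meas.comp (measurable_const.prodMk (measurable_const.mul measurable_id))

lemma gwd_mul_int {t : ℝ} (ht0 : 0 ≤ t) (ht1 : t < 1) (i l : ℕ) (c : ℝ) :
    IntegrableOn (fun z : ℝ => gwd t i z * (c * Real.exp (-((1 - t) * z)) ^ l)) (Set.Ioi 0) ∧
    ∫ z in Set.Ioi (0:ℝ), gwd t i z * (c * Real.exp (-((1 - t) * z)) ^ l) =
      (1 - t) * t ^ i * c * (1 / (1 + l * (1 - t))) ^ (i + 1) := by
  have ht : 0 < 1 - t := by linarith
  have hr : 0 < 1 + l * (1 - t) := by positivity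
  obtain ⟨h1, h2⟩ := gw_gamma i hr
  have e : (fun z : ℝ => gwd t i z * (c * Real.exp (-((1 - t) * z)) ^ l)) = fun z =>
      ((1 - t) * t ^ i * c * (1 / (Nat.factorial i : ℝ))) * (z ^ i * Real.exp (-((1 + l * (1 - t)) * z))) := by
    funext z
    have : Real.exp (-((1 + l * (1 - t)) * z)) = Real.exp (-z) * Real.exp (-((1 - t) * z)) ^ l := by
      rw [← Real.exp_nat_mul, ← Real.exp_add]; congr 1; ring
    rw [this, gwd, mul_pow]; ring
  rw [e]
  refine ⟨h1.const_mul _, ?_⟩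
  rw [integral_const_mul, h2]
  have : (Nat.factorial i : ℝ) ≠ 0 := by positivity
  field_simp

lemma gwrho_univ {t : ℝ} (ht0 : 0 ≤ t) (ht1 : t < 1) (i : ℕ) :
    gwrho t i Set.univ = ENNReal.ofReal ((1 - t) * t ^ i) := by
  obtain ⟨h1, h2⟩ := gwd_mul_int ht0 ht1 i 0 1
  simp only [pow_zero, mul_one, Nat.cast_zero, zero_mul, add_zero, div_one, one_pow] at h1 h2
  rw [gwrho, withDensity_apply _ MeasurableSet.univ, Measure.restrict_univ,
    ← ofReal_integral_eq_lintegral_ofReal h1, h2]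
  filter_upwards [ae_restrict_mem measurableSet_Ioi] with z hz
  exact gwd_nonneg ht0 ht1 i (le_of_lt hz)

lemma gwnu_univ {t : ℝ} (ht0 : 0 ≤ t) (ht1 : t < 1) : gwnu t Set.univ = 1 := by
  have ht : 0 < 1 - t := by linarith
  rw [gwnu, Measure.sum_apply _ MeasurableSet.univ]
  have : ∀ i, ((gwrho t i).map fun z => gwT (i + 1) ((1 - t) * z)) Set.univ =
      ENNReal.ofReal ((1 - t) * t ^ i) := fun i => by
    rw [Measure.map_apply (gwTi_meas t i) MeasurableSet.univ, Set.preimage_univ, gwrho_univ ht0 ht1]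
  rw [tsum_congr this, ← ENNReal.ofReal_tsum_of_nonneg (fun i => by positivity)
    ((summable_geometric_of_lt_one ht0 ht1).mul_left _), tsum_mul_left, tsum_geometric_of_lt_one ht0 ht1,
    mul_inv_cancel₀ ht.ne', ENNReal.ofReal_one]

lemma gwnu_frontier {t : ℝ} (ht0 : 0 ≤ t) (ht1 : t < 1) (j : ℕ) {a : ℝ} (ha : 0 < a) :
    gwnu t (frontier (gwE j a)) = 0 := by
  have ht : 0 < 1 - t := by linarith
  rw [gwnu, Measure.sum_apply _ isClosed_frontier.measurableSet, ENNReal.tsum_eq_zero]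
  intro i
  rw [Measure.map_apply (gwTi_meas t i) isClosed_frontier.measurableSet]
  have hsub : (fun z => gwT (i + 1) ((1 - t) * z)) ⁻¹' frontier (gwE j a) ⊆ {a / (1 - t)} := by
    intro z hz
    have := gwE_frontier j ha _ _ hz
    rw [Set.mem_singleton_iff, eq_div_iff ht.ne', mul_comm]; exact this
  refine measure_mono_null hsub ?_
  refine withDensity_absolutelyContinuous _ _ ?_
  exact measure_mono_null Set.Subset.rfl (by simp)

lemma gwnu_E {t : ℝ} (ht0 : 0 ≤ t) (ht1 : t < 1) (j : ℕ) (hj : 1 ≤ j) {a : ℝ} (ha : 0 < a) :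
    (gwnu t).real (gwE j a) = (1 - t) * (1 / (Nat.factorial (j - 1) : ℝ)) *
          ∫ z in (0 : ℝ)..(a / (1 - t)), (t * z) ^ (j - 1) * Real.exp (-z) := by
  have ht : 0 < 1 - t := by linarith
  obtain ⟨i, rfl⟩ : ∃ i, j = i + 1 := ⟨j - 1, by omega⟩
  simp only [add_tsub_cancel_right]
  rw [Measure.real, gwnu, Measure.sum_apply _ (gwE_meas _ _)]
  have hpre : ∀ k, (fun z => gwT (k + 1) ((1 - t) * z)) ⁻¹' (gwE (i + 1) a) =
      {z | k = i ∧ z ≤ a / (1 - t)} := by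
    intro k
    ext z
    rw [Set.mem_preimage, gwE_mem _ ha, Set.mem_ofPred_eq, le_div_iff₀ ht, mul_comm z, Nat.succ_inj]
  rw [tsum_eq_single i]
  · rw [Measure.map_apply (gwTi_meas t i) (gwE_meas _ _), hpre]
    simp only [true_and]
    have hac : 0 ≤ a / (1 - t) := by positivity
    have hms : MeasurableSet {z : ℝ | z ≤ a / (1 - t)} := measurableSet_Iic
    rw [gwrho, withDensity_apply _ hms, Measure.restrict_restrict hms]
    have : {z : ℝ | z ≤ a / (1 - t)} ∩ Set.Ioi 0 = Set.Ioc 0 (a / (1 - t)) := by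
      ext z; simp [and_comm]
    rw [this, ← ofReal_integral_eq_lintegral_ofReal
      ((gwd_cont t i).integrableOn_Ioc), ENNReal.toReal_ofReal, ← intervalIntegral.integral_of_le hac]
    · simp only [gwd]
      rw [intervalIntegral.integral_const_mul]
    · exact setIntegral_nonneg measurableSet_Ioc fun z hz => gwd_nonneg ht0 ht1 i hz.1.le
    · filter_upwards [ae_restrict_mem measurableSet_Ioc] with z hz
      exact gwd_nonneg ht0 ht1 i hz.1.le
  · intro k hk
    rw [Measure.map_apply (gwTi_meas t k) (gwE_meas _ _), hpre]
    simp [hk]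

lemma gwnu_moment {t : ℝ} (ht0 : 0 ≤ t) (ht1 : t < 1) (k l : ℕ) :
    ∫ q, (q.1:ℝ) ^ k * (q.2:ℝ) ^ l ∂(gwnu t) =
      (1 - t) * ((1 / 2) ^ k * (1 / (1 + l * (1 - t)))) /
        (1 - t * ((1 / 2) ^ k * (1 / (1 + l * (1 - t))))) := by
  have ht : 0 < 1 - t := by linarith
  have hfin : IsFiniteMeasure (gwnu t) := ⟨by rw [gwnu_univ ht0 ht1]; exact ENNReal.one_lt_top⟩
  let F : C(I × I, ℝ) := ⟨fun q => (q.1:ℝ) ^ k * (q.2:ℝ) ^ l, by fun_prop⟩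
  have hint : Integrable (fun q : I × I => (q.1:ℝ) ^ k * (q.2:ℝ) ^ l) (gwnu t) :=
    (BoundedContinuousFunction.mkOfCompact F).integrable _
  have h1 := hasSum_integral_measure hint
  have hd2 : 0 < 1 + l * (1 - t) := by positivity
  set φ := 1 / (1 + l * (1 - t)) with hφ
  have hφ1 : φ ≤ 1 := by
    rw [hφ, div_le_one hd2]
    have : 0 ≤ l * (1 - t) := by positivity
    linarith
  have hφ0 : 0 ≤ φ := by positivity
  set s : ℝ := (1 / 2) ^ k with hs
  have hs0 : 0 ≤ s := by positivity
  have hs1 : s ≤ 1 := pow_le_one₀ (by norm_num) (by norm_num)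
  have hsφ : s * φ ≤ 1 := mul_le_one₀ hs1 hφ0 hφ1
  have hsφ0 : 0 ≤ s * φ := by positivity
  have e : ∀ i : ℕ, ∫ q, (q.1:ℝ) ^ k * (q.2:ℝ) ^ l ∂((gwrho t i).map fun z => gwT (i + 1) ((1 - t) * z)) =
      ((1 - t) * (s * φ)) * (t * (s * φ)) ^ i := by
    intro i
    rw [integral_map (gwTi_meas t i).aemeasurable 
        (Continuous.aestronglyMeasurable (by fun_prop)), gwrho,
      integral_withDensity_eq_integral_toReal_smul
        ((gwd_cont t i).measurable.ennreal_ofReal) (Eventually.of_forall fun _ => ENNReal.ofReal_lt_top)]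
    have := (gwd_mul_int ht0 ht1 i l (s ^ (i + 1))).2
    rw [show ((1 - t) * (s * φ)) * (t * (s * φ)) ^ i = (1 - t) * t ^ i * s ^ (i + 1) * φ ^ (i + 1) by ring,
      ← this]
    refine setIntegral_congr_fun measurableSet_Ioi fun z hz => ?_
    have hz : 0 < z := hz
    simp only [smul_eq_mul]
    rw [ENNReal.toReal_ofReal (gwd_nonneg ht0 ht1 i hz.le), gwT_fst, gwT_snd _ (by positivity), hs,
      ← pow_mul, ← pow_mul, mul_comm k]
  simp only [e] at h1
  have h2 := (hasSum_geometric_of_lt_one (r := t * (s * φ)) (by positivity) (by nlinarith)).mul_left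
    ((1 - t) * (s * φ))
  rw [← div_eq_mul_inv] at h2
  exact h1.unique h2

lemma gw_core {Ω : Type*} [MeasurableSpace Ω] (μ : Measure Ω) [IsProbabilityMeasure μ]
    {B : ℝ} (hB : 0 < B) {t : ℝ} (ht0 : 0 ≤ t) (ht1 : t < 1) (W Z : ℕ → Ω → ℕ)
    (hW : ∀ n, Measurable (W n)) (hZ : ∀ n, Measurable (Z n))
    (H : ∀ k l : ℕ, Tendsto (fun n : ℕ => B * n * ∫ ω in {ω | 0 < Z n ω},
      ((1 / 2 : ℝ) ^ k) ^ (W n ω) * Real.exp (-((l:ℝ) / (B * n))) ^ Z n ω ∂μ) atTop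
      (𝓝 ((1 - t) * ((1 / 2) ^ k * (1 / (1 + l * (1 - t)))) /
        (1 - t * ((1 / 2) ^ k * (1 / (1 + l * (1 - t))))))))
    {a : ℝ} (ha : 0 < a) (j : ℕ) (hj : 1 ≤ j) :
    Tendsto (fun n : ℕ => B * n * (μ ({ω | W n ω = j} ∩
              {ω | 0 < Z n ω ∧ (Z n ω : ℝ) ≤ a * B * n})).toReal) atTop
      (𝓝 ((1 - t) * (1 / (Nat.factorial (j - 1) : ℝ)) *
          ∫ z in (0 : ℝ)..(a / (1 - t)), (t * z) ^ (j - 1) * Real.exp (-z))) := by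
  have hfin : IsFiniteMeasure (gwnu t) := ⟨by rw [gwnu_univ ht0 ht1]; exact ENNReal.one_lt_top⟩
  let ν0 : FiniteMeasure (I × I) := ⟨gwnu t, hfin⟩
  let f : ℕ → Ω → I × I := fun n ω => gwT (W n ω) (Z n ω / (B * n))
  have hf : ∀ n, Measurable (f n) := fun n => by
    refine gwT_meas.comp ((hW n).prodMk (Measurable.div_const ?_ _))
    exact measurable_from_nat.comp (hZ n)
  let ν : ℕ → FiniteMeasure (I × I) := fun n =>
    ⟨(Real.toNNReal (B * n)) • (μ.restrict {ω | 0 < Z n ω}).map (f n), inferInstance⟩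
  have hBn : ∀ n : ℕ, ((Real.toNNReal (B * n) : NNReal) : ℝ) = B * n := fun n =>
    Real.coe_toNNReal _ (by positivity)
  have hlim : Tendsto ν atTop (𝓝 ν0) := by
    refine gw_sw ν ν0 fun k l => ?_
    have e0 : ∫ q, (q.1:ℝ) ^ k * (q.2:ℝ) ^ l ∂(ν0 : Measure (I × I)) = _ := gwnu_moment ht0 ht1 k l
    rw [e0]
    refine (H k l).congr fun n => ?_
    show _ = ∫ q, (q.1:ℝ) ^ k * (q.2:ℝ) ^ l ∂((Real.toNNReal (B * n)) • (μ.restrict {ω | 0 < Z n ω}).map (f n))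
    rw [integral_smul_nnreal_measure, NNReal.smul_def, hBn, smul_eq_mul,
      integral_map (hf n).aemeasurable
        (Continuous.aestronglyMeasurable (by fun_prop))]
    congr 2
    funext ω
    have hz : 0 ≤ (Z n ω : ℝ) / (B * n) := by positivity
    simp only [f]
    rw [gwT_fst, gwT_snd _ hz, ← pow_mul, ← pow_mul, mul_comm k, ← Real.exp_nat_mul, ← Real.exp_nat_mul]
    congr 2
    ring
  have hne : ν0 ≠ 0 := by
    intro h
    have h1 : (ν0 : Measure (I × I)) Set.univ = 1 := gwnu_univ ht0 ht1
    rw [h] at h1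
    simp at h1
  have := gw_portmanteau ν ν0 hlim hne (gwE j a) (gwnu_frontier ht0 ht1 j ha)
  have e1 : (ν0 : Measure (I × I)).real (gwE j a) = _ := gwnu_E ht0 ht1 j hj ha
  rw [e1] at this
  refine this.congr' ?_
  filter_upwards [eventually_gt_atTop 0] with n hn
  have hn : (0:ℝ) < n := by exact_mod_cast hn
  show ((Real.toNNReal (B * n)) • (μ.restrict {ω | 0 < Z n ω}).map (f n)).real (gwE j a) = _
  rw [measureReal_nnreal_smul_apply, hBn, Measure.real, Measure.map_apply (hf n) (gwE_meas _ _),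
    Measure.restrict_apply ((hf n) (gwE_meas _ _))]
  congr 3
  ext ω
  simp only [Set.mem_inter_iff, Set.mem_preimage, Set.mem_ofPred_eq, f]
  rw [gwE_mem j ha, div_le_iff₀ (by positivity), ← mul_assoc]
  tauto

end core

theorem reduced_process_conditional_limit_linear    (p : ℕ → ℝ) (hp0 : ∀ k, 0 ≤ p k) (hp1 : ∑' k, p k = 1)
    (hmean : ∑' k : ℕ, (k : ℝ) * p k = 1) (B : ℝ) (hB : 0 < B)
    (hsq : Summable fun k : ℕ => (k : ℝ) ^ 2 * p k)
    (hvar : (∑' k : ℕ, (k : ℝ) ^ 2 * p k) - 1 = 2 * B)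
    (hgcd : ∀ d : ℕ, (∀ k, 0 < p k → d ∣ k) → d = 1)
    {Ω : Type*} [MeasurableSpace Ω] (μ : Measure Ω) [IsProbabilityMeasure μ]
    (Z : ℕ → Ω → ℕ) (hZm : ∀ n, Measurable (Z n))
    (hZ : ∀ n, ∀ s ∈ Set.Icc (0 : ℝ) 1, ∫ ω, s ^ Z n ω ∂μ = pgfIter p n s)
    (Zred : ℕ → ℕ → Ω → ℕ) (hZredm : ∀ m n, Measurable (Zred m n))
    (hjoint : ∀ m n, m ≤ n → ∀ s ∈ Set.Icc (0 : ℝ) 1, ∀ u ∈ Set.Icc (0 : ℝ) 1,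
      ∫ ω, s ^ Zred m n ω * u ^ Z n ω ∂μ =
        pgfIter p m (pgfIter p (n - m) 0 +
          s * (pgfIter p (n - m) u - pgfIter p (n - m) 0))) :
    ∀ t : ℝ, 0 ≤ t → t < 1 → ∀ a : ℝ, 0 < a → ∀ j : ℕ, 1 ≤ j →
      Tendsto (fun n : ℕ =>
          (μ ({ω | Zred ⌊t * (n : ℝ)⌋₊ n ω = j} ∩
              {ω | 0 < Z n ω ∧ (Z n ω : ℝ) ≤ a * B * n})).toReal /
            (μ {ω | 0 < Z n ω ∧ (Z n ω : ℝ) ≤ a * B * n}).toReal)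
        atTop
        (𝓝 ((1 - t) / (1 - Real.exp (-a)) * (1 / (Nat.factorial (j - 1) : ℝ)) *
          ∫ z in (0 : ℝ)..(a / (1 - t)), (t * z) ^ (j - 1) * Real.exp (-z))) := by
  intro t ht0 ht1 a ha j hj
  have hs : ∀ k : ℕ, (1 / 2 : ℝ) ^ k ∈ Set.Icc (0:ℝ) 1 := fun k =>
    ⟨by positivity, pow_le_one₀ (by norm_num) (by norm_num)⟩
  have hnum := gw_core μ hB ht0 ht1 (fun n => Zred ⌊t * (n : ℝ)⌋₊ n) Z (fun n => hZredm _ n) hZm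
    (fun k l => gw_moment_num μ p hp0 hp1 hmean B hB hsq hvar Z hZm Zred hZredm hjoint t ht0 ht1
      _ (hs k) l) ha j hj
  have hden := gw_core μ hB le_rfl zero_lt_one (fun _ _ => 1) Z (fun n => measurable_const) hZm
    (fun k l => gw_moment_den μ p hp0 hp1 hmean B hB hsq hvar Z hZm hZ _ (hs k) l) ha 1 le_rfl
  have hI : ∫ z in (0:ℝ)..a, Real.exp (-z) = 1 - Real.exp (-a) := by
    rw [intervalIntegral.integral_comp_neg (fun z => Real.exp z)]
    simp
  have hval : ((1:ℝ) - 0) * (1 / (Nat.factorial (1 - 1) : ℝ)) *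
          ∫ z in (0 : ℝ)..(a / (1 - 0)), (0 * z) ^ (1 - 1) * Real.exp (-z) = 1 - Real.exp (-a) := by
    simp [hI]
  rw [hval] at hden
  have hpos : 1 - Real.exp (-a) ≠ 0 := by
    have : Real.exp (-a) < 1 := by rw [← Real.exp_zero]; exact Real.exp_lt_exp.2 (by linarith)
    linarith
  have hq := hnum.div hden hpos
  have e : (1 - t) / (1 - Real.exp (-a)) * (1 / (Nat.factorial (j - 1) : ℝ)) *
          (∫ z in (0 : ℝ)..(a / (1 - t)), (t * z) ^ (j - 1) * Real.exp (-z)) =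
      (1 - t) * (1 / (Nat.factorial (j - 1) : ℝ)) *
          (∫ z in (0 : ℝ)..(a / (1 - t)), (t * z) ^ (j - 1) * Real.exp (-z)) / (1 - Real.exp (-a)) := by
    ring
  rw [e]
  refine hq.congr' ?_
  filter_upwards [eventually_gt_atTop 0] with n hn
  have hn : (0:ℝ) < n := by exact_mod_cast hn
  have hset : ({ω : Ω | (1:ℕ) = 1} ∩ {ω | 0 < Z n ω ∧ (Z n ω : ℝ) ≤ a * B * n}) =
      {ω | 0 < Z n ω ∧ (Z n ω : ℝ) ≤ a * B * n} := by simp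
  rw [Pi.div_apply, hset, mul_div_mul_left _ _ (by positivity)]
end

section
/- Assume g.c.d.{k: f_k>0}=1, E[ξ]=1, Var(ξ)=2B ∈ (0,∞). Then for any fixed t ∈ [0,1), a > 0 and s ∈ [0,1]: lim_{n→∞} E[s^{Z(⌊nt⌋,n)} | 0 < Z(n) ≤ aBn] = s · ((1-t)/(1-ts)) · (1 - e^{-(1-ts)a/(1-t)})/(1 - e^{-a}). -/
open MeasureTheory Filter Topology Asymptotics Real

noncomputable def qk (k : ℕ) (x : ℝ) : ℝ := ∑ j ∈ Finset.range k, ∑ i ∈ Finset.range j, x ^ i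

lemma qk_id (k : ℕ) (x : ℝ) : (1 - x) ^ 2 * qk k x = x ^ k - 1 + k * (1 - x) := by
  have h : ∀ j : ℕ, (1 - x) * ∑ i ∈ Finset.range j, x ^ i = 1 - x ^ j := fun j => mul_neg_geom_sum x j
  induction k with
  | zero => simp [qk]
  | succ k ih =>
    have : qk (k+1) x = qk k x + ∑ i ∈ Finset.range k, x ^ i := by
      simp [qk, Finset.sum_range_succ]
    rw [this, mul_add, ih, pow_two, mul_assoc, h]
    push_cast; ring

lemma qk_one (k : ℕ) : qk k 1 = (k ^ 2 - k) / 2 := by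
  induction k with
  | zero => simp [qk]
  | succ k ih =>
    have : qk (k+1) 1 = qk k 1 + ∑ i ∈ Finset.range k, (1:ℝ) ^ i := by
      simp [qk, Finset.sum_range_succ]
    rw [this, ih]
    simp; ring

lemma qk_nonneg (k : ℕ) {x : ℝ} (hx : 0 ≤ x) : 0 ≤ qk k x := by
  unfold qk; positivity

lemma qk_le (k : ℕ) {x : ℝ} (hx : 0 ≤ x) (hx1 : x ≤ 1) : qk k x ≤ qk k 1 := by
  unfold qk; gcongr

lemma qk_ge (k : ℕ) (hk : 2 ≤ k) {x : ℝ} (hx : 0 ≤ x) : 1 ≤ qk k x := by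
  unfold qk
  have h1 : ∑ i ∈ Finset.range 1, x ^ i ≤ ∑ j ∈ Finset.range k, ∑ i ∈ Finset.range j, x ^ i :=
    Finset.single_le_sum (f := fun j => ∑ i ∈ Finset.range j, x ^ i)
      (fun j _ => by positivity) (Finset.mem_range.2 (by omega))
  simpa using h1

structure Hyp (p : ℕ → ℝ) (B : ℝ) : Prop where
  hp0 : ∀ k, 0 ≤ p k
  hp1 : ∑' k, p k = 1
  hmean : ∑' k : ℕ, (k : ℝ) * p k = 1
  hB : 0 < B
  hsq : Summable fun k : ℕ => (k : ℝ) ^ 2 * p k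
  hvar : (∑' k : ℕ, (k : ℝ) ^ 2 * p k) - 1 = 2 * B

namespace Hyp
variable {p : ℕ → ℝ} {B : ℝ}

lemma s0 (H : Hyp p B) : Summable p := by
  by_contra h
  have := H.hp1
  rw [tsum_eq_zero_of_not_summable h] at this
  norm_num at this

lemma s1 (H : Hyp p B) : Summable fun k : ℕ => (k : ℝ) * p k := by
  by_contra h
  have := H.hmean
  rw [tsum_eq_zero_of_not_summable h] at this
  norm_num at this

lemma sx (H : Hyp p B) {x : ℝ} (hx : 0 ≤ x) (hx1 : x ≤ 1) : Summable fun k => p k * x ^ k :=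
  H.s0.of_nonneg_of_le (fun k => mul_nonneg (H.hp0 k) (pow_nonneg hx k))
    (fun k => mul_le_of_le_one_right (H.hp0 k) (pow_le_one₀ hx hx1))

lemma exk (H : Hyp p B) : ∃ k, 2 ≤ k ∧ 0 < p k := by
  by_contra! h
  have h0 : ∀ k : ℕ, (k:ℝ)^2 * p k = k * p k := by
    intro k
    rcases Nat.lt_or_ge k 2 with hk | hk
    · interval_cases k <;> simp
    · have : p k = 0 := le_antisymm (h k hk) (H.hp0 k)
      simp [this]
  have := H.hvar
  simp_rw [h0] at this
  rw [H.hmean] at this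
  linarith [H.hB]

noncomputable def R (p : ℕ → ℝ) (x : ℝ) : ℝ := ∑' k, p k * qk k x

lemma sq1 (H : Hyp p B) : Summable fun k => p k * qk k 1 := by
  have : (fun k => p k * qk k 1) = fun k : ℕ => ((k : ℝ) ^ 2 * p k - k * p k) / 2 := by
    ext k; rw [qk_one]; ring
  rw [this]
  exact (H.hsq.sub H.s1).div_const 2

lemma R1 (H : Hyp p B) : R p 1 = B := by
  unfold R
  have : (fun k => p k * qk k 1) = fun k : ℕ => ((k : ℝ) ^ 2 * p k - k * p k) / 2 := by
    ext k; rw [qk_one]; ring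
  rw [this, tsum_div_const, H.hsq.tsum_sub H.s1, H.hmean, H.hvar]
  ring

lemma sq (H : Hyp p B) {x : ℝ} (hx : 0 ≤ x) (hx1 : x ≤ 1) : Summable fun k => p k * qk k x :=
  H.sq1.of_nonneg_of_le (fun k => mul_nonneg (H.hp0 k) (qk_nonneg k hx))
    (fun k => mul_le_mul_of_nonneg_left (qk_le k hx hx1) (H.hp0 k))

lemma R_le (H : Hyp p B) {x : ℝ} (hx : 0 ≤ x) (hx1 : x ≤ 1) : R p x ≤ B := by
  rw [← H.R1]
  exact (H.sq hx hx1).tsum_le_tsum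
    (fun k => mul_le_mul_of_nonneg_left (qk_le k hx hx1) (H.hp0 k)) H.sq1

lemma R_ge (H : Hyp p B) {k : ℕ} (hk : 2 ≤ k) {x : ℝ} (hx : 0 ≤ x) (hx1 : x ≤ 1) :
    p k ≤ R p x := by
  refine le_trans ?_ ((H.sq hx hx1).le_tsum k
    (fun k _ => mul_nonneg (H.hp0 k) (qk_nonneg k hx)))
  exact le_mul_of_one_le_right (H.hp0 k) (qk_ge k hk hx)

lemma R_id (H : Hyp p B) {x : ℝ} (hx : 0 ≤ x) (hx1 : x ≤ 1) :
    pgf p x = x + (1 - x) ^ 2 * R p x := by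
  unfold R pgf
  rw [← tsum_mul_left]
  have : (fun k => (1 - x) ^ 2 * (p k * qk k x)) =
      fun k : ℕ => p k * x ^ k - p k + (k * p k) * (1 - x) := by
    ext k
    have := qk_id k x
    linear_combination p k * this
  rw [this, Summable.tsum_add ((H.sx hx hx1).sub H.s0) (H.s1.mul_right _),
    (H.sx hx hx1).tsum_sub H.s0, tsum_mul_right, H.hmean, H.hp1]
  ring

lemma R_lim (H : Hyp p B) : Tendsto (R p) (𝓝[<] 1) (𝓝 B) := by
  rw [← H.R1]
  unfold R
  refine tendsto_tsum_of_dominated_convergence (bound := fun k => p k * qk k 1) H.sq1 ?_ ?_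
  · intro k
    have : Continuous fun x => p k * qk k x := by unfold qk; fun_prop
    exact (this.tendsto 1).mono_left nhdsWithin_le_nhds
  · filter_upwards [Ioo_mem_nhdsLT (show (0:ℝ) < 1 by norm_num)] with x hx k
    rw [Real.norm_of_nonneg (mul_nonneg (H.hp0 k) (qk_nonneg k hx.1.le))]
    exact mul_le_mul_of_nonneg_left (qk_le k hx.1.le hx.2.le) (H.hp0 k)

lemma one_sub_ge (H : Hyp p B) {k : ℕ} (hk : 1 ≤ k) {x : ℝ} (hx : 0 ≤ x) (hx1 : x ≤ 1) :
    p k * (1 - x) ≤ 1 - pgf p x := by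
  have e : 1 - pgf p x = ∑' k, (p k - p k * x ^ k) := by
    rw [H.s0.tsum_sub (H.sx hx hx1), H.hp1]; rfl
  rw [e]
  have : ∀ k, 0 ≤ p k - p k * x ^ k := fun k => by
    have := mul_le_of_le_one_right (H.hp0 k) (pow_le_one₀ (n := k) hx hx1)
    linarith
  refine le_trans ?_ ((H.s0.sub (H.sx hx hx1)).le_tsum k (fun k _ => this k))
  have h2 : x ^ k ≤ x := pow_le_of_le_one hx hx1 (by omega)
  nlinarith [H.hp0 k]

lemma pgf_one (H : Hyp p B) : pgf p 1 = 1 := by simp [pgf, H.hp1]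

lemma pgf_mem (H : Hyp p B) {x : ℝ} (hx : 0 ≤ x) (hx1 : x < 1) : x ≤ pgf p x ∧ pgf p x < 1 := by
  obtain ⟨k, hk, hpk⟩ := H.exk
  have h1 := H.one_sub_ge (k := k) (by omega) hx hx1.le
  have h2 := H.R_ge hk hx hx1.le
  have h3 := H.R_id hx hx1.le
  have h4 : 0 < p k * (1 - x) := mul_pos hpk (by linarith)
  have h5 : 0 ≤ (1 - x) ^ 2 * R p x := mul_nonneg (sq_nonneg _) (by linarith)
  constructor <;> linarith

noncomputable def hh (p : ℕ → ℝ) (x : ℝ) : ℝ := 1 / (1 - pgf p x) - 1 / (1 - x)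

lemma hh_eq (H : Hyp p B) {x : ℝ} (hx : 0 ≤ x) (hx1 : x < 1) :
    hh p x = R p x / (1 - R p x * (1 - x)) := by
  have h3 := H.R_id hx hx1.le
  have h1 := (H.pgf_mem hx hx1).2
  have h0 : 0 < 1 - x := by linarith
  have e : 1 - pgf p x = (1 - x) * (1 - R p x * (1 - x)) := by rw [h3]; ring
  have h2 : 0 < 1 - R p x * (1 - x) := by
    have : 0 < (1 - x) * (1 - R p x * (1 - x)) := by rw [← e]; linarith
    exact (pos_iff_pos_of_mul_pos this).1 h0
  unfold hh
  rw [e, div_sub_div _ _ (mul_pos h0 h2).ne' h0.ne', div_eq_div_iff (by positivity) h2.ne']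
  ring

lemma hh_lim (H : Hyp p B) : Tendsto (hh p) (𝓝[<] 1) (𝓝 B) := by
  have h1 : Tendsto (fun x : ℝ => 1 - x) (𝓝[<] 1) (𝓝 (1 - 1)) :=
    ((continuous_const.sub continuous_id).tendsto (1:ℝ)).mono_left nhdsWithin_le_nhds
  have h2 : Tendsto (fun x => R p x / (1 - R p x * (1 - x))) (𝓝[<] 1)
      (𝓝 (B / (1 - B * (1 - 1)))) :=
    H.R_lim.div (tendsto_const_nhds.sub (H.R_lim.mul h1)) (by simp)
  have : B / (1 - B * (1 - 1)) = B := by simp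
  rw [this] at h2
  refine h2.congr' ?_
  filter_upwards [Ioo_mem_nhdsLT (show (0:ℝ) < 1 by norm_num)] with x hx
  exact (H.hh_eq hx.1.le hx.2).symm

lemma hh_bd (H : Hyp p B) : ∃ c M : ℝ, 0 < c ∧ ∀ x, 0 ≤ x → x < 1 → c ≤ hh p x ∧ hh p x ≤ M := by
  obtain ⟨k, hk, hpk⟩ := H.exk
  refine ⟨p k, B / p k, hpk, fun x hx hx1 => ?_⟩
  have h1 := H.one_sub_ge (k := k) (by omega) hx hx1.le
  have h2 := H.R_ge hk hx hx1.le
  have h3 := H.R_id hx hx1.le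
  have h0 : 0 < 1 - x := by linarith
  have e : 1 - pgf p x = (1 - x) * (1 - R p x * (1 - x)) := by rw [h3]; ring
  have h4 : p k ≤ 1 - R p x * (1 - x) := by
    rw [e, mul_comm] at h1
    exact le_of_mul_le_mul_left h1 h0
  have h5 := H.R_le hx hx1.le
  rw [H.hh_eq hx hx1]
  constructor
  · rw [le_div_iff₀ (by linarith)]
    have : 0 ≤ R p x * (1 - x) := mul_nonneg (by linarith) h0.le
    nlinarith
  · exact div_le_div₀ H.hB.le h5 hpk h4

lemma iter_mem (H : Hyp p B) {x : ℝ} (hx : 0 ≤ x) (hx1 : x < 1) (n : ℕ) :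
    x ≤ pgfIter p n x ∧ pgfIter p n x < 1 := by
  induction n with
  | zero => exact ⟨le_rfl, hx1⟩
  | succ n ih =>
    have := H.pgf_mem (hx.trans ih.1) ih.2
    exact ⟨ih.1.trans this.1, this.2⟩

lemma iter_one (H : Hyp p B) (n : ℕ) : pgfIter p n 1 = 1 := by
  induction n with
  | zero => rfl
  | succ n ih => simp only [pgfIter, ih, H.pgf_one]

lemma iter_sum (x : ℝ) (n : ℕ) :
    1 / (1 - pgfIter p n x) - 1 / (1 - x) = ∑ j ∈ Finset.range n, hh p (pgfIter p j x) := by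
  induction n with
  | zero => simp [pgfIter]
  | succ n ih =>
    rw [Finset.sum_range_succ, ← ih]
    simp only [pgfIter, hh]; ring

lemma unif (H : Hyp p B) (ε : ℝ) (hε : 0 < ε) : ∃ C : ℝ, 0 ≤ C ∧ ∀ n : ℕ, ∀ x, 0 ≤ x → x < 1 →
    |1 / (1 - pgfIter p n x) - 1 / (1 - x) - B * n| ≤ C + ε * n := by
  obtain ⟨c, M, hc, hM⟩ := H.hh_bd
  have h1 := (Metric.tendsto_nhds.1 H.hh_lim ε hε)
  obtain ⟨l, hl, hl'⟩ := (mem_nhdsLT_iff_exists_Ioo_subset (a := (1:ℝ))).1 h1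
  have hl0 : 0 < 1 - l := by simpa using hl
  obtain ⟨J, hJ⟩ := exists_nat_gt (1 / (1 - l) / c)
  have far : ∀ j, J ≤ j → ∀ x, 0 ≤ x → x < 1 → |hh p (pgfIter p j x) - B| ≤ ε := by
    intro j hj x hx hx1
    have hm := H.iter_mem hx hx1 j
    have hs := iter_sum (p := p) x j
    have h2 : (j:ℝ) * c ≤ ∑ i ∈ Finset.range j, hh p (pgfIter p i x) := by
      have := Finset.card_nsmul_le_sum (Finset.range j) (fun i => hh p (pgfIter p i x)) c
        (fun i _ => (hM _ (hx.trans (H.iter_mem hx hx1 i).1) (H.iter_mem hx hx1 i).2).1)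
      simpa using this
    have h3 : 1 / (1 - l) < j * c := by
      rw [div_lt_iff₀ hc] at hJ
      have : (J:ℝ) ≤ j := by exact_mod_cast hj
      nlinarith
    have h4 : 0 < 1 / (1 - x) := by
      have : 0 < 1 - x := by linarith
      positivity
    have h5 : 1 / (1 - l) < 1 / (1 - pgfIter p j x) := by linarith
    have h6 : 1 - pgfIter p j x < 1 - l := lt_of_one_div_lt_one_div hl0 h5
    have := hl' (show pgfIter p j x ∈ Set.Ioo l 1 from ⟨by linarith, hm.2⟩)
    have h7 : dist (hh p (pgfIter p j x)) B < ε := this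
    rw [Real.dist_eq] at h7
    exact h7.le
  have hMB : 0 ≤ M + B := by
    have := hM 0 le_rfl one_pos
    linarith [H.hB]
  refine ⟨J * (M + B), by positivity, fun n x hx hx1 => ?_⟩
  rw [iter_sum]
  have e : ∑ j ∈ Finset.range n, hh p (pgfIter p j x) - B * n =
      ∑ j ∈ Finset.range n, (hh p (pgfIter p j x) - B) := by
    simp; ring
  rw [e]
  induction n with
  | zero => simp; positivity
  | succ n ih =>
    have := ih (by simp; ring)
    rcases Nat.lt_or_ge n J with h | h
    · clear this ih
      have h1 : |∑ j ∈ Finset.range (n+1), (hh p (pgfIter p j x) - B)| ≤ (n+1 : ℕ) * (M + B) := by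
        refine (Finset.abs_sum_le_sum_abs _ _).trans ?_
        have := Finset.sum_le_card_nsmul (Finset.range (n+1)) (fun j => |hh p (pgfIter p j x) - B|)
          (M + B) (fun i _ => by
            have := (hM _ (hx.trans (H.iter_mem hx hx1 i).1) (H.iter_mem hx hx1 i).2)
            have := H.hB
            rw [abs_le]; constructor <;> linarith)
        rw [nsmul_eq_mul, Finset.card_range] at this
        exact this
      have h2 : ((n+1 : ℕ):ℝ) ≤ J := by exact_mod_cast h
      have h3 : ((n+1 : ℕ):ℝ) * (M + B) ≤ J * (M + B) := by gcongr
      have : 0 ≤ ε * ((n+1 : ℕ):ℝ) := by positivity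
      linarith
    · rw [Finset.sum_range_succ]
      refine (abs_add_le _ _).trans ?_
      have := far n h x hx hx1
      push_cast
      linarith

/-- inverse form -/
lemma limA (H : Hyp p B) (m : ℕ → ℕ) (x : ℕ → ℝ) (τ y : ℝ)
    (hm : Tendsto (fun n : ℕ => (m n : ℝ) / n) atTop (𝓝 τ))
    (hx : ∀ᶠ n in atTop, 0 ≤ x n ∧ x n < 1)
    (hy : Tendsto (fun n : ℕ => 1 / (1 - x n) / (B * n)) atTop (𝓝 y)) :
    Tendsto (fun n : ℕ => 1 / (1 - pgfIter p (m n) (x n)) / (B * n)) atTop (𝓝 (y + τ)) := by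
  have key : Tendsto (fun n : ℕ => (1 / (1 - pgfIter p (m n) (x n)) - 1 / (1 - x n) - B * m n) / n)
      atTop (𝓝 0) := by
    rw [Metric.tendsto_nhds]
    intro ε hε
    have hτ : 0 < |τ| + 1 := by positivity
    obtain ⟨C, hC, hC'⟩ := H.unif (ε / 2 / (|τ| + 1)) (by positivity)
    have h1 : ∀ᶠ n : ℕ in atTop, (m n : ℝ) / n < |τ| + 1 :=
      hm.eventually (gt_mem_nhds (by linarith [le_abs_self τ]))
    have h2 : Tendsto (fun n : ℕ => C / (n:ℝ)) atTop (𝓝 0) := tendsto_const_div_atTop_nhds_zero_nat C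
    have h3 : ∀ᶠ n : ℕ in atTop, C / (n:ℝ) < ε / 2 := h2.eventually (gt_mem_nhds (by positivity))
    filter_upwards [h1, h3, hx, eventually_gt_atTop 0] with n h1 h3 hx hn
    have hn' : (0:ℝ) < n := by exact_mod_cast hn
    rw [dist_zero_right, Real.norm_eq_abs, abs_div, abs_of_pos hn']
    have := hC' (m n) (x n) hx.1 hx.2
    calc _ ≤ (C + ε / 2 / (|τ| + 1) * m n) / n := by gcongr
      _ = C / n + ε / 2 / (|τ| + 1) * (m n / n) := by ring
      _ < ε / 2 + ε / 2 / (|τ| + 1) * (|τ| + 1) := by gcongr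
      _ = ε := by field_simp; ring
  have hB := H.hB
  have := (hy.add hm).add (key.div_const B)
  rw [zero_div, add_zero] at this
  refine this.congr' ?_
  filter_upwards [eventually_gt_atTop 0] with n hn
  have hn' : (0:ℝ) < n := by exact_mod_cast hn
  generalize 1 / (1 - pgfIter p (m n) (x n)) = A
  generalize 1 / (1 - x n) = D
  field_simp
  ring

lemma limB (H : Hyp p B) (m : ℕ → ℕ) (x : ℕ → ℝ) (τ c : ℝ) (hτ : 0 ≤ τ) (hc : 0 ≤ c)
    (hm : Tendsto (fun n : ℕ => (m n : ℝ) / n) atTop (𝓝 τ))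
    (hx : ∀ᶠ n in atTop, 0 ≤ x n ∧ x n ≤ 1)
    (hy : Tendsto (fun n : ℕ => B * n * (1 - x n)) atTop (𝓝 c)) :
    Tendsto (fun n : ℕ => B * n * (1 - pgfIter p (m n) (x n))) atTop (𝓝 (c / (1 + c * τ))) := by
  have hB := H.hB
  rcases hc.eq_or_lt with rfl | hc
  · rw [zero_div]
    refine squeeze_zero' ?_ ?_ hy
    · filter_upwards [hx] with n hx
      have : pgfIter p (m n) (x n) ≤ 1 := by
        rcases hx.2.eq_or_lt with h | h
        · rw [h, H.iter_one]
        · exact (H.iter_mem hx.1 h _).2.le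
      have : 0 ≤ 1 - pgfIter p (m n) (x n) := by linarith
      positivity
    · filter_upwards [hx] with n hx
      have : x n ≤ pgfIter p (m n) (x n) := by
        rcases hx.2.eq_or_lt with h | h
        · rw [h, H.iter_one]
        · exact (H.iter_mem hx.1 h _).1
      gcongr
  · have hx' : ∀ᶠ n in atTop, 0 ≤ x n ∧ x n < 1 := by
      filter_upwards [hx, hy.eventually (lt_mem_nhds hc)] with n hx h
      refine ⟨hx.1, lt_of_le_of_ne hx.2 ?_⟩
      intro h1
      simp [h1] at h
    have h1 := H.limA m x τ (c⁻¹) hm hx' ((hy.inv₀ hc.ne').congr (fun n => by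
      rw [mul_inv, one_div]; ring))
    have h2 : c⁻¹ + τ ≠ 0 := by positivity
    have h3 : (c⁻¹ + τ)⁻¹ = c / (1 + c * τ) := by field_simp
    rw [← h3]
    refine (h1.inv₀ h2).congr (fun n => ?_)
    rw [div_eq_mul_inv, mul_inv, inv_inv, one_div, inv_inv]; ring
end Hyp

section kar
lemma kar_ii {φ g : ℝ → ℝ} (hφ : Continuous φ) (hg : Continuous g) (u v : ℝ) :
    IntervalIntegrable (fun y => φ y * g y) volume u v := (hφ.mul hg).intervalIntegrable u v

variable {Ω : Type*} [MeasurableSpace Ω] {μ : Measure Ω}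

lemma kar_int {w Y : Ω → ℝ} (hw : Integrable w μ) (hY : Measurable Y)
    (hY1 : ∀ ω, Y ω ∈ Set.Icc (0:ℝ) 1) {g : ℝ → ℝ} (hg : Continuous g) :
    Integrable (fun ω => w ω * g (Y ω)) μ := by
  obtain ⟨C, hC⟩ := (isCompact_Icc (a := (0:ℝ)) (b := 1)).exists_bound_of_continuousOn hg.continuousOn
  exact hw.mul_bdd (c := C) (hg.measurable.comp hY).aestronglyMeasurable
    (Eventually.of_forall fun ω => hC _ (hY1 ω))

lemma kar_poly {φ : ℝ → ℝ} (hφ : Continuous φ) {w Y : ℕ → Ω → ℝ}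
    (hw : ∀ n, Integrable (w n) μ) (hY : ∀ n, Measurable (Y n))
    (hY1 : ∀ n ω, Y n ω ∈ Set.Icc (0:ℝ) 1)
    (hmom : ∀ k : ℕ, Tendsto (fun n => ∫ ω, w n ω * Y n ω ^ k ∂μ) atTop
      (𝓝 (∫ y in (0:ℝ)..1, φ y * y ^ k))) (P : Polynomial ℝ) :
    Tendsto (fun n => ∫ ω, w n ω * P.eval (Y n ω) ∂μ) atTop
      (𝓝 (∫ y in (0:ℝ)..1, φ y * P.eval y)) := by
  induction P using Polynomial.induction_on' with
  | add p q hp hq =>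
    have e1 : ∀ n, ∫ ω, w n ω * (p+q).eval (Y n ω) ∂μ =
        ∫ ω, w n ω * p.eval (Y n ω) ∂μ + ∫ ω, w n ω * q.eval (Y n ω) ∂μ := fun n => by
      rw [← integral_add (kar_int (hw n) (hY n) (hY1 n) p.continuous)
        (kar_int (hw n) (hY n) (hY1 n) q.continuous)]
      simp [mul_add]
    have e2 : ∫ y in (0:ℝ)..1, φ y * (p+q).eval y =
        (∫ y in (0:ℝ)..1, φ y * p.eval y) + ∫ y in (0:ℝ)..1, φ y * q.eval y := by
      rw [← intervalIntegral.integral_add (kar_ii hφ p.continuous _ _)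
        (kar_ii hφ q.continuous _ _)]
      simp [mul_add]
    simp_rw [e1]
    rw [e2]
    exact hp.add hq
  | monomial k c =>
    have e1 : ∀ n, ∫ ω, w n ω * (Polynomial.monomial k c).eval (Y n ω) ∂μ =
        c * ∫ ω, w n ω * Y n ω ^ k ∂μ := fun n => by
      rw [← integral_const_mul]
      congr 1; ext ω; simp; ring
    have e2 : ∫ y in (0:ℝ)..1, φ y * (Polynomial.monomial k c).eval y =
        c * ∫ y in (0:ℝ)..1, φ y * y ^ k := by
      rw [← intervalIntegral.integral_const_mul]
      congr 1; ext ω; simp; ring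
    simp_rw [e1]
    rw [e2]
    exact (hmom k).const_mul c

lemma kar_cont {φ : ℝ → ℝ} (hφ : Continuous φ) (hφ0 : ∀ y ∈ Set.Icc (0:ℝ) 1, 0 ≤ φ y)
    {w Y : ℕ → Ω → ℝ}
    (hw : ∀ n, Integrable (w n) μ) (hw0 : ∀ n ω, 0 ≤ w n ω) (hY : ∀ n, Measurable (Y n))
    (hY1 : ∀ n ω, Y n ω ∈ Set.Icc (0:ℝ) 1)
    (hmom : ∀ k : ℕ, Tendsto (fun n => ∫ ω, w n ω * Y n ω ^ k ∂μ) atTop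
      (𝓝 (∫ y in (0:ℝ)..1, φ y * y ^ k))) {g : ℝ → ℝ} (hg : Continuous g) :
    Tendsto (fun n => ∫ ω, w n ω * g (Y n ω) ∂μ) atTop
      (𝓝 (∫ y in (0:ℝ)..1, φ y * g y)) := by
  set K := ∫ y in (0:ℝ)..1, φ y with hK
  have hK0 : 0 ≤ K := intervalIntegral.integral_nonneg zero_le_one hφ0
  have hm0 : Tendsto (fun n => ∫ ω, w n ω ∂μ) atTop (𝓝 K) := by simpa using hmom 0
  rw [Metric.tendsto_nhds]
  intro ε hε
  set η := ε / (3 * (K + 1)) with hη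
  have hη0 : 0 < η := by positivity
  have hηK : η * (K + 1) = ε / 3 := by rw [hη]; field_simp
  obtain ⟨P, hP⟩ := exists_polynomial_near_of_continuousOn 0 1 g hg.continuousOn η hη0
  have hPl := kar_poly hφ hw hY hY1 hmom P
  filter_upwards [Metric.tendsto_nhds.1 hPl (ε/3) (by positivity),
    hm0.eventually (gt_mem_nhds (show K < K + 1 by linarith))] with n h1 h2
  have a1 : |(∫ ω, w n ω * P.eval (Y n ω) ∂μ) - ∫ ω, w n ω * g (Y n ω) ∂μ| ≤ η * ∫ ω, w n ω ∂μ := by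
    rw [← integral_sub (kar_int (hw n) (hY n) (hY1 n) P.continuous)
      (kar_int (hw n) (hY n) (hY1 n) hg), ← integral_const_mul, ← Real.norm_eq_abs]
    refine norm_integral_le_of_norm_le ((hw n).const_mul η) (Eventually.of_forall fun ω => ?_)
    rw [← mul_sub, norm_mul, Real.norm_of_nonneg (hw0 n ω), mul_comm]
    exact mul_le_mul_of_nonneg_right (hP _ (hY1 n ω)).le (hw0 n ω)
  have a2 : |(∫ y in (0:ℝ)..1, φ y * P.eval y) - ∫ y in (0:ℝ)..1, φ y * g y| ≤ η * K := by
    rw [← intervalIntegral.integral_sub (kar_ii hφ P.continuous _ _)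
        (kar_ii hφ hg _ _), hK, ← intervalIntegral.integral_const_mul,
        ← Real.norm_eq_abs]
    refine intervalIntegral.norm_integral_le_of_norm_le zero_le_one
      (Eventually.of_forall fun y hy => ?_) ((hφ.const_mul η).intervalIntegrable _ _)
    have hy' : y ∈ Set.Icc (0:ℝ) 1 := ⟨hy.1.le, hy.2⟩
    rw [← mul_sub, norm_mul, Real.norm_of_nonneg (hφ0 y hy'), mul_comm]
    exact mul_le_mul_of_nonneg_right (hP _ hy').le (hφ0 y hy')
  rw [Real.dist_eq] at h1 ⊢
  have a3 : η * ∫ ω, w n ω ∂μ < ε / 3 := by rw [← hηK]; gcongr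
  have a4 : η * K < ε / 3 := by rw [← hηK]; gcongr; linarith
  rw [abs_le] at a1 a2
  rw [abs_lt] at h1 ⊢
  constructor <;> linarith

lemma kar {φ : ℝ → ℝ} (hφ : Continuous φ) (hφ0 : ∀ y ∈ Set.Icc (0:ℝ) 1, 0 ≤ φ y)
    {w Y : ℕ → Ω → ℝ}
    (hw : ∀ n, Integrable (w n) μ) (hw0 : ∀ n ω, 0 ≤ w n ω) (hY : ∀ n, Measurable (Y n))
    (hY1 : ∀ n ω, Y n ω ∈ Set.Icc (0:ℝ) 1)
    (hmom : ∀ k : ℕ, Tendsto (fun n => ∫ ω, w n ω * Y n ω ^ k ∂μ) atTop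
      (𝓝 (∫ y in (0:ℝ)..1, φ y * y ^ k))) {b : ℝ} (hb0 : 0 < b) (hb1 : b < 1) :
    Tendsto (fun n => ∫ ω in {ω | b ≤ Y n ω}, w n ω ∂μ) atTop
      (𝓝 (∫ y in b..1, φ y)) := by
  have hF : Continuous fun x => ∫ y in x..1, φ y := by
    have : (fun x => ∫ y in x..1, φ y) = fun x => - ∫ y in (1:ℝ)..x, φ y := by
      ext x; rw [intervalIntegral.integral_symm]
    rw [this]
    exact (intervalIntegral.continuous_primitive (fun a b => hφ.intervalIntegrable a b) 1).neg
  -- the ramp functions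
  let G : ℝ → ℝ → ℝ → ℝ := fun c δ y => max 0 (min 1 ((y - c) / δ))
  have hGc : ∀ c δ, Continuous (G c δ) := fun c δ => by
    simp only [G]; fun_prop
  have hG0 : ∀ c δ y, 0 ≤ G c δ y := fun c δ y => le_max_left _ _
  have hG1 : ∀ c δ y, G c δ y ≤ 1 := fun c δ y => max_le zero_le_one (min_le_left _ _)
  have hGz : ∀ c δ y, 0 < δ → y ≤ c → G c δ y = 0 := fun c δ y hδ h => by
    have : (y - c) / δ ≤ 0 := div_nonpos_of_nonpos_of_nonneg (by linarith) hδ.le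
    exact max_eq_left ((min_le_right _ _).trans this)
  have hGo : ∀ c δ y, 0 < δ → c + δ ≤ y → G c δ y = 1 := fun c δ y hδ h => by
    have : 1 ≤ (y - c) / δ := by rw [le_div_iff₀ hδ]; linarith
    simp [G, this]
  have hI : ∀ n, MeasurableSet {ω | b ≤ Y n ω} := fun n => measurableSet_le measurable_const (hY n)
  have hii : ∀ c δ u v, IntervalIntegrable (fun y => φ y * G c δ y) volume u v := fun c δ u v =>
    (hφ.mul (hGc c δ)).intervalIntegrable _ _
  refine tendsto_order.2 ⟨fun l hl => ?_, fun l hl => ?_⟩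
  · -- lower
    obtain ⟨x, hbx, hx1, hx⟩ : ∃ x, b < x ∧ x < 1 ∧ l < ∫ y in x..1, φ y := by
      have h1 := (hF.tendsto b).eventually (lt_mem_nhds hl)
      have h2 : ∀ᶠ x in 𝓝[>] b, b < x ∧ x < 1 := Ioo_mem_nhdsGT hb1
      obtain ⟨x, h, h'⟩ := ((h1.filter_mono nhdsWithin_le_nhds).and h2).exists
      exact ⟨x, h'.1, h'.2, h⟩
    have hδ : 0 < x - b := by linarith
    have hlim := kar_cont hφ hφ0 hw hw0 hY hY1 hmom (hGc b (x - b))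
    have hlt : l < ∫ y in (0:ℝ)..1, φ y * G b (x - b) y := by
      refine hx.trans_le ?_
      rw [← intervalIntegral.integral_add_adjacent_intervals (hii _ _ 0 x) (hii _ _ x 1)]
      have : 0 ≤ ∫ y in (0:ℝ)..x, φ y * G b (x - b) y :=
        intervalIntegral.integral_nonneg (by linarith) fun y hy =>
          mul_nonneg (hφ0 y ⟨hy.1, by linarith [hy.2]⟩) (hG0 _ _ _)
      have h2 : ∫ y in x..1, φ y * G b (x - b) y = ∫ y in x..1, φ y := by
        refine intervalIntegral.integral_congr fun y hy => ?_
        rw [Set.uIcc_of_le hx1.le] at hy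
        rw [hGo _ _ _ hδ (by linarith [hy.1]), mul_one]
      linarith
    filter_upwards [hlim.eventually (lt_mem_nhds hlt)] with n hn
    refine hn.trans_le ?_
    rw [← integral_indicator (hI n)]
    refine integral_mono (kar_int (hw n) (hY n) (hY1 n) (hGc _ _)) ((hw n).indicator (hI n)) ?_
    intro ω
    by_cases h : b ≤ Y n ω
    · simp only [Set.indicator, Set.mem_ofPred_eq, h, if_true]
      exact mul_le_of_le_one_right (hw0 n ω) (hG1 _ _ _)
    · simp only [Set.indicator, Set.mem_ofPred_eq, h, if_false]
      rw [hGz _ _ _ hδ (by linarith), mul_zero]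
  · obtain ⟨x, hbx, hx1, hx⟩ : ∃ x, x < b ∧ 0 < x ∧ ∫ y in x..1, φ y < l := by
      have h1 := (hF.tendsto b).eventually (gt_mem_nhds hl)
      have h2 : ∀ᶠ x in 𝓝[<] b, 0 < x ∧ x < b := Ioo_mem_nhdsLT hb0
      obtain ⟨x, h, h'⟩ := ((h1.filter_mono nhdsWithin_le_nhds).and h2).exists
      exact ⟨x, h'.2, h'.1, h⟩
    have hδ : 0 < b - x := by linarith
    have hlim := kar_cont hφ hφ0 hw hw0 hY hY1 hmom (hGc x (b - x))
    have hlt : ∫ y in (0:ℝ)..1, φ y * G x (b - x) y < l := by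
      refine lt_of_le_of_lt ?_ hx
      rw [← intervalIntegral.integral_add_adjacent_intervals (hii _ _ 0 x) (hii _ _ x 1)]
      have : ∫ y in x..1, φ y * G x (b - x) y ≤ ∫ y in x..1, φ y :=
        intervalIntegral.integral_mono_on (by linarith) (hii _ _ _ _) (hφ.intervalIntegrable _ _)
          fun y hy => mul_le_of_le_one_right (hφ0 y ⟨by linarith [hy.1], hy.2⟩) (hG1 _ _ _)
      have h2 : ∫ y in (0:ℝ)..x, φ y * G x (b - x) y = ∫ y in (0:ℝ)..x, (0:ℝ) := by
        refine intervalIntegral.integral_congr fun y hy => ?_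
        rw [Set.uIcc_of_le hx1.le] at hy
        rw [hGz _ _ _ hδ hy.2, mul_zero]
      rw [intervalIntegral.integral_zero] at h2
      linarith
    filter_upwards [hlim.eventually (gt_mem_nhds hlt)] with n hn
    refine lt_of_le_of_lt ?_ hn
    rw [← integral_indicator (hI n)]
    refine integral_mono ((hw n).indicator (hI n)) (kar_int (hw n) (hY n) (hY1 n) (hGc _ _)) ?_
    intro ω
    by_cases h : b ≤ Y n ω
    · simp only [Set.indicator, Set.mem_ofPred_eq, h, if_true]
      rw [hGo _ _ _ hδ (by linarith), mul_one]
    · simp only [Set.indicator, Set.mem_ofPred_eq, h, if_false]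
      exact mul_nonneg (hw0 n ω) (hG0 _ _ _)
end kar

lemma core_lim (p : ℕ → ℝ) (B : ℝ) (H : Hyp p B)
    {Ω : Type*} [MeasurableSpace Ω] (μ : Measure Ω) [IsProbabilityMeasure μ]
    (Z : ℕ → Ω → ℕ) (hZm : ∀ n, Measurable (Z n))
    (Zred : ℕ → ℕ → Ω → ℕ) (hZredm : ∀ m n, Measurable (Zred m n))
    (hjoint : ∀ m n, m ≤ n → ∀ s ∈ Set.Icc (0 : ℝ) 1, ∀ u ∈ Set.Icc (0 : ℝ) 1,
      ∫ ω, s ^ Zred m n ω * u ^ Z n ω ∂μ =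
        pgfIter p m (pgfIter p (n - m) 0 +
          s * (pgfIter p (n - m) u - pgfIter p (n - m) 0)))
    (t : ℝ) (ht0 : 0 ≤ t) (ht1 : t < 1) (a : ℝ) (ha : 0 < a) (s : ℝ) (hs : s ∈ Set.Icc (0 : ℝ) 1) :
    Tendsto (fun n : ℕ => B * n *
          ∫ ω in {ω | 0 < Z n ω ∧ (Z n ω : ℝ) ≤ a * B * n},
              s ^ Zred ⌊t * (n : ℝ)⌋₊ n ω ∂μ) atTop
      (𝓝 (s * ((1 - t) / (1 - t * s)) * (1 - Real.exp (-(1 - t * s) * a / (1 - t))))) := by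
  have hB := H.hB
  obtain ⟨hs0, hs1⟩ := hs
  have h1t : 0 < 1 - t := by linarith
  have hts : 1 - t ≤ 1 - t * s := by nlinarith
  have hts0 : 0 < 1 - t * s := by linarith
  set r : ℝ := (1 - t * s) / (1 - t) with hr
  have hr1 : 1 ≤ r := by rw [hr, le_div_iff₀ h1t]; linarith
  set m : ℕ → ℕ := fun n => ⌊t * (n : ℝ)⌋₊ with hm
  have hmn : ∀ n, m n ≤ n := fun n => by
    have : (m n : ℝ) ≤ t * n := Nat.floor_le (by positivity)
    have h2 : t * (n:ℝ) ≤ n := by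
      have : (0:ℝ) ≤ n := by positivity
      nlinarith
    exact_mod_cast this.trans h2
  have hml : Tendsto (fun n : ℕ => (m n : ℝ) / n) atTop (𝓝 t) :=
    (tendsto_nat_floor_mul_div_atTop ht0).comp tendsto_natCast_atTop_atTop
  have hml' : Tendsto (fun n : ℕ => ((n - m n : ℕ) : ℝ) / n) atTop (𝓝 (1 - t)) := by
    refine (tendsto_const_nhds.sub hml).congr' ?_
    filter_upwards [eventually_gt_atTop 0] with n hn
    have hn' : (0:ℝ) < n := by exact_mod_cast hn
    rw [Nat.cast_sub (hmn n)]
    field_simp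
  -- extinction probability asymptotics
  have hq : Tendsto (fun n : ℕ => B * n * (1 - pgfIter p (n - m n) 0)) atTop (𝓝 (1 - t)⁻¹) := by
    have h1 := H.limA (fun n => n - m n) (fun _ => 0) (1 - t) 0 hml'
      (Eventually.of_forall fun n => ⟨le_rfl, one_pos⟩) (by
        have := (tendsto_const_div_atTop_nhds_zero_nat (1 / (1 - 0) / B : ℝ))
        refine this.congr fun n => ?_
        rw [div_div])
    rw [zero_add] at h1
    refine (h1.inv₀ h1t.ne').congr (fun n => ?_)
    rw [div_eq_mul_inv, mul_inv, inv_inv, one_div, inv_inv]; ring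
  have hit : ∀ n x, 0 ≤ x → x ≤ 1 → 0 ≤ pgfIter p n x ∧ pgfIter p n x ≤ 1 := fun n x hx hx1 => by
    rcases hx1.eq_or_lt with h | h
    · rw [h, H.iter_one]; norm_num
    · exact ⟨hx.trans (H.iter_mem hx h n).1, (H.iter_mem hx h n).2.le⟩
  set w : ℕ → Ω → ℝ := fun n ω => B * n * (s ^ Zred (m n) n ω * (1 - 0 ^ Z n ω)) with hw
  set Y : ℕ → Ω → ℝ := fun n ω => Real.exp (-(Z n ω / (B * n))) with hY
  have hcast : ∀ n, Measurable fun ω => (Z n ω : ℝ) := fun n =>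
    (measurable_from_top (f := fun k : ℕ => (k : ℝ))).comp (hZm n)
  have hpz : ∀ (u : ℝ) n, Measurable fun ω => u ^ Z n ω := fun u n =>
    (measurable_from_top (f := fun k : ℕ => u ^ k)).comp (hZm n)
  have hpr : ∀ (u : ℝ) k n, Measurable fun ω => u ^ Zred k n ω := fun u k n =>
    (measurable_from_top (f := fun k : ℕ => u ^ k)).comp (hZredm k n)
  have hYm : ∀ n, Measurable (Y n) := fun n => by
    exact ((hcast n).div_const _).neg.exp
  have hY1 : ∀ n ω, Y n ω ∈ Set.Icc (0:ℝ) 1 := fun n ω => by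
    refine ⟨(Real.exp_pos _).le, Real.exp_le_one_iff.2 ?_⟩
    have : 0 ≤ (Z n ω : ℝ) / (B * n) := by positivity
    linarith
  have h01 : ∀ j : ℕ, (0:ℝ) ≤ 0 ^ j ∧ (0:ℝ) ^ j ≤ 1 := fun j =>
    ⟨pow_nonneg le_rfl j, pow_le_one₀ le_rfl zero_le_one⟩
  have hsr : ∀ j : ℕ, 0 ≤ s ^ j ∧ s ^ j ≤ 1 := fun j => ⟨pow_nonneg hs0 j, pow_le_one₀ hs0 hs1⟩
  have hint : ∀ u : ℝ, 0 ≤ u → u ≤ 1 → ∀ n,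
      Integrable (fun ω => s ^ Zred (m n) n ω * u ^ Z n ω) μ := fun u hu hu1 n => by
    refine Integrable.of_bound ((hpr s _ _).mul (hpz u n)).aestronglyMeasurable 1
      (Eventually.of_forall fun ω => ?_)
    rw [Real.norm_of_nonneg (mul_nonneg (hsr _).1 (pow_nonneg hu _))]
    exact mul_le_one₀ (hsr _).2 (pow_nonneg hu _) (pow_le_one₀ hu hu1)
  have hwi : ∀ n, Integrable (w n) μ := fun n => by
    have := ((hint 1 zero_le_one le_rfl n).sub (hint 0 le_rfl zero_le_one n)).const_mul (B * n)
    refine this.congr (Eventually.of_forall fun ω => ?_)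
    simp [hw, mul_sub]
  have hw0 : ∀ n ω, 0 ≤ w n ω := fun n ω => by
    have h1 := (hsr (Zred (m n) n ω)).1
    have h2 : 0 ≤ 1 - (0:ℝ) ^ Z n ω := by linarith [(h01 (Z n ω)).2]
    simp only [hw]
    positivity
  set φ : ℝ → ℝ := fun y => s * y ^ (r - 1) with hφd
  have hφ : Continuous φ := continuous_const.mul (Real.continuous_rpow_const (by linarith))
  have hφ0 : ∀ y ∈ Set.Icc (0:ℝ) 1, 0 ≤ φ y := fun y hy =>
    mul_nonneg hs0 (Real.rpow_nonneg hy.1 _)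
  have hmom : ∀ k : ℕ, Tendsto (fun n => ∫ ω, w n ω * Y n ω ^ k ∂μ) atTop
      (𝓝 (∫ y in (0:ℝ)..1, φ y * y ^ k)) := by
    intro k
    have eI : ∫ y in (0:ℝ)..1, φ y * y ^ k = s / (r + k) := by
      have : ∫ y in (0:ℝ)..1, φ y * y ^ k = ∫ y in (0:ℝ)..1, s * y ^ (r - 1 + k) := by
        refine intervalIntegral.integral_congr_ae (Eventually.of_forall fun y hy => ?_)
        rw [Set.uIoc_of_le zero_le_one] at hy
        simp only [hφd]
        rw [Real.rpow_add hy.1, Real.rpow_natCast, mul_assoc]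
      have hk : (0:ℝ) ≤ k := by positivity
      rw [this, intervalIntegral.integral_const_mul, integral_rpow (Or.inl (by linarith)),
        Real.one_rpow, Real.zero_rpow (by linarith)]
      ring_nf
    set u : ℕ → ℝ := fun n => Real.exp (-(k / (B * n))) with hu
    have hu01 : ∀ n, 0 ≤ u n ∧ u n ≤ 1 := fun n => by
      refine ⟨(Real.exp_pos _).le, Real.exp_le_one_iff.2 ?_⟩
      have : 0 ≤ (k : ℝ) / (B * n) := by positivity
      linarith
    have hul : Tendsto (fun n : ℕ => B * n * (1 - u n)) atTop (𝓝 k) := by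
      have hz : Tendsto (fun n : ℕ => (k:ℝ) / (B * n)) atTop (𝓝 0) :=
        (tendsto_const_div_atTop_nhds_zero_nat ((k:ℝ) / B)).congr fun n => by rw [div_div]
      rcases Nat.eq_zero_or_pos k with rfl | hk
      · simp [hu]
      have hk' : (0:ℝ) < k := by exact_mod_cast hk
      have hd : HasDerivAt (fun x : ℝ => -Real.exp (-x)) 1 0 := by
        have := ((hasDerivAt_neg (0:ℝ)).exp).neg
        rw [neg_zero, Real.exp_zero, one_mul, neg_neg] at this
        exact this
      have h1 := hd.tendsto_slope_zero
      have h2 : Tendsto (fun n : ℕ => (k:ℝ) / (B * n)) atTop (𝓝[≠] 0) := by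
        refine tendsto_nhdsWithin_iff.2 ⟨hz, ?_⟩
        filter_upwards [eventually_gt_atTop 0] with n hn
        have hn' : (0:ℝ) < n := by exact_mod_cast hn
        have : (k:ℝ) / (B * n) ≠ 0 := by positivity
        exact this
      have h3 := (h1.comp h2).const_mul (k:ℝ)
      rw [mul_one] at h3
      refine h3.congr' ?_
      filter_upwards [eventually_gt_atTop 0] with n hn
      have hn' : (0:ℝ) < n := by exact_mod_cast hn
      simp only [Function.comp, hu, zero_add, neg_zero, Real.exp_zero, smul_eq_mul]
      generalize Real.exp (-(k / (B * n))) = E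
      field_simp
      ring
    have hfu := H.limB (fun n => n - m n) u (1 - t) k h1t.le (by positivity) hml'
      (Eventually.of_forall hu01) hul
    have ha1 : Tendsto (fun n : ℕ => B * n * (1 - (pgfIter p (n - m n) 0 +
          s * (pgfIter p (n - m n) (u n) - pgfIter p (n - m n) 0)))) atTop
        (𝓝 ((1 - s) * (1 - t)⁻¹ + s * (k / (1 + k * (1 - t))))) := by
      refine ((hq.const_mul (1 - s)).add (hfu.const_mul s)).congr fun n => ?_
      ring
    have hx01 : ∀ n, 0 ≤ pgfIter p (n - m n) 0 +
          s * (pgfIter p (n - m n) (u n) - pgfIter p (n - m n) 0) ∧ pgfIter p (n - m n) 0 +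
          s * (pgfIter p (n - m n) (u n) - pgfIter p (n - m n) 0) ≤ 1 := fun n => by
      have h1 := hit (n - m n) 0 le_rfl zero_le_one
      have h2 := hit (n - m n) (u n) (hu01 n).1 (hu01 n).2
      constructor <;> nlinarith
    have hc0 : 0 ≤ (1 - s) * (1 - t)⁻¹ + s * (k / (1 + k * (1 - t))) := by
      have : 0 ≤ 1 - s := by linarith
      positivity
    have hb1 := H.limB m _ t _ ht0 hc0 hml (Eventually.of_forall hx01) ha1
    have hb2 := H.limB m _ t _ ht0 (by positivity) hml
      (Eventually.of_forall fun n => hit (n - m n) 0 le_rfl zero_le_one) hq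
    have hfin := hb2.sub hb1
    have hval : (1 - t)⁻¹ / (1 + (1 - t)⁻¹ * t) -
        ((1 - s) * (1 - t)⁻¹ + s * (k / (1 + k * (1 - t)))) /
          (1 + ((1 - s) * (1 - t)⁻¹ + s * (k / (1 + k * (1 - t)))) * t) = s / (r + k) := by
      have hk : (0:ℝ) ≤ k := by positivity
      have hD : 0 < 1 + k * (1 - t) := by positivity
      have e1 : (1 - t)⁻¹ / (1 + (1 - t)⁻¹ * t) = 1 := by
        have : 1 + (1 - t)⁻¹ * t = (1 - t)⁻¹ := by field_simp; ring
        rw [this, div_self (by positivity)]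
      have e2 : (1 - s) * (1 - t)⁻¹ + s * (k / (1 + k * (1 - t))) =
          (1 - s + k * (1 - t)) / ((1 - t) * (1 + k * (1 - t))) := by
        rw [eq_div_iff (by positivity)]
        field_simp
        ring
      have hE : 0 < 1 - t * s + k * (1 - t) := by positivity
      have e3 : 1 + (1 - s + k * (1 - t)) / ((1 - t) * (1 + k * (1 - t))) * t =
          (1 - t * s + k * (1 - t)) / ((1 - t) * (1 + k * (1 - t))) := by
        rw [eq_div_iff (by positivity), add_mul, div_mul_eq_mul_div, div_mul_cancel₀ _ (by positivity)]
        ring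
      have e4 : r + k = (1 - t * s + k * (1 - t)) / (1 - t) := by
        rw [hr]; field_simp
      rw [e1, e2, e3, e4, div_div_div_cancel_right₀ (by positivity), div_div_eq_mul_div,
        eq_div_iff hE.ne', sub_mul, div_mul_cancel₀ _ hE.ne']
      ring
    rw [eI, ← hval]
    refine hfin.congr fun n => ?_
    have hj1 := hjoint (m n) n (hmn n) s ⟨hs0, hs1⟩ (u n) (hu01 n)
    have hj0 := hjoint (m n) n (hmn n) s ⟨hs0, hs1⟩ 0 ⟨le_rfl, zero_le_one⟩
    rw [sub_self, mul_zero, add_zero] at hj0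
    rw [← hj1, ← hj0]
    have : ∀ ω, w n ω * Y n ω ^ k = B * n * (s ^ Zred (m n) n ω * u n ^ Z n ω -
        s ^ Zred (m n) n ω * 0 ^ Z n ω) := fun ω => by
      have e : Y n ω ^ k = u n ^ Z n ω := by
        simp only [hY, hu]
        rw [← Real.exp_nat_mul, ← Real.exp_nat_mul]
        congr 1; ring
      rw [e]
      simp only [hw]
      rcases Nat.eq_zero_or_pos (Z n ω) with h | h
      · simp [h]
      · rw [zero_pow h.ne']; ring
    simp_rw [this]
    rw [integral_const_mul, integral_sub (hint _ (hu01 n).1 (hu01 n).2 n)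
      (hint 0 le_rfl zero_le_one n)]
    ring
  have hres := kar hφ hφ0 hwi hw0 hYm hY1 hmom (Real.exp_pos (-a))
    (Real.exp_lt_one_iff.2 (by linarith))
  have hval : ∫ y in Real.exp (-a)..1, φ y =
      s * ((1 - t) / (1 - t * s)) * (1 - Real.exp (-(1 - t * s) * a / (1 - t))) := by
    simp only [hφd]
    rw [intervalIntegral.integral_const_mul, integral_rpow (Or.inl (by linarith)),
      Real.one_rpow, sub_add_cancel, ← Real.exp_mul]
    have e1 : -a * r = -(1 - t * s) * a / (1 - t) := by rw [hr]; ring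
    rw [e1, hr]
    field_simp
  rw [hval] at hres
  refine hres.congr' ?_
  filter_upwards [eventually_gt_atTop 0] with n hn
  have hn' : (0:ℝ) < n := by exact_mod_cast hn
  have hYa : ∀ ω, Real.exp (-a) ≤ Y n ω ↔ (Z n ω : ℝ) ≤ a * B * n := fun ω => by
    simp only [hY]
    rw [Real.exp_le_exp, neg_le_neg_iff, div_le_iff₀ (by positivity), mul_assoc]
  have hA : MeasurableSet {ω | 0 < Z n ω ∧ (Z n ω : ℝ) ≤ a * B * n} :=
    (measurableSet_lt measurable_const (hZm n)).inter (measurableSet_le (hcast n) measurable_const)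
  rw [← integral_const_mul, ← integral_indicator hA,
    ← integral_indicator (measurableSet_le measurable_const (hYm n))]
  congr 1
  ext ω
  simp only [Set.indicator, Set.mem_ofPred_eq, hYa]
  rcases Nat.eq_zero_or_pos (Z n ω) with h | h
  · simp [h, hw]
  · simp [h, h.ne', hw, hm]

theorem reduced_process_generating_limit_linear    (p : ℕ → ℝ) (hp0 : ∀ k, 0 ≤ p k) (hp1 : ∑' k, p k = 1)
    (hmean : ∑' k : ℕ, (k : ℝ) * p k = 1) (B : ℝ) (hB : 0 < B)
    (hsq : Summable fun k : ℕ => (k : ℝ) ^ 2 * p k)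
    (hvar : (∑' k : ℕ, (k : ℝ) ^ 2 * p k) - 1 = 2 * B)
    (hgcd : ∀ d : ℕ, (∀ k, 0 < p k → d ∣ k) → d = 1)
    {Ω : Type*} [MeasurableSpace Ω] (μ : Measure Ω) [IsProbabilityMeasure μ]
    (Z : ℕ → Ω → ℕ) (hZm : ∀ n, Measurable (Z n))
    (hZ : ∀ n, ∀ s ∈ Set.Icc (0 : ℝ) 1, ∫ ω, s ^ Z n ω ∂μ = pgfIter p n s)
    (Zred : ℕ → ℕ → Ω → ℕ) (hZredm : ∀ m n, Measurable (Zred m n))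
    (hjoint : ∀ m n, m ≤ n → ∀ s ∈ Set.Icc (0 : ℝ) 1, ∀ u ∈ Set.Icc (0 : ℝ) 1,
      ∫ ω, s ^ Zred m n ω * u ^ Z n ω ∂μ =
        pgfIter p m (pgfIter p (n - m) 0 +
          s * (pgfIter p (n - m) u - pgfIter p (n - m) 0))) :
    ∀ t : ℝ, 0 ≤ t → t < 1 → ∀ a : ℝ, 0 < a → ∀ s ∈ Set.Icc (0 : ℝ) 1,
      Tendsto (fun n : ℕ =>
          (∫ ω in {ω | 0 < Z n ω ∧ (Z n ω : ℝ) ≤ a * B * n},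
              s ^ Zred ⌊t * (n : ℝ)⌋₊ n ω ∂μ) /
            (μ {ω | 0 < Z n ω ∧ (Z n ω : ℝ) ≤ a * B * n}).toReal)
        atTop
        (𝓝 (s * ((1 - t) / (1 - t * s)) *
          (1 - Real.exp (-(1 - t * s) * a / (1 - t))) / (1 - Real.exp (-a)))) := by
  intro t ht0 ht1 a ha s hs
  have H : Hyp p B := ⟨hp0, hp1, hmean, hB, hsq, hvar⟩
  have h1 := core_lim p B H μ Z hZm Zred hZredm hjoint t ht0 ht1 a ha s hs
  have h2 := core_lim p B H μ Z hZm Zred hZredm hjoint t ht0 ht1 a ha 1 ⟨zero_le_one, le_rfl⟩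
  have h1t : 0 < 1 - t := by linarith
  have e : (1:ℝ) * ((1 - t) / (1 - t * 1)) * (1 - Real.exp (-(1 - t * 1) * a / (1 - t))) =
      1 - Real.exp (-a) := by
    have : -(1 - t * 1) * a / (1 - t) = -a := by field_simp
    rw [this, mul_one, div_self h1t.ne']; ring
  rw [e] at h2
  have hpos : 0 < 1 - Real.exp (-a) := by
    have := Real.exp_lt_one_iff.2 (show -a < 0 by linarith)
    linarith
  refine (h1.div h2 hpos.ne').congr' ?_
  filter_upwards [eventually_gt_atTop 0] with n hn
  have hn' : (0:ℝ) < n := by exact_mod_cast hn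
  simp only [Pi.div_apply]
  rw [mul_div_mul_left _ _ (by positivity)]
  congr 1
  simp [Measure.real]
end
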